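/- (Lemma 2.3) Assume (h1), (h2) and (h3), and let the continuous function f satisfy (f1) and (f2). If {u_n} is a sequence in X with sup_n ‖u_n‖ < ∞ which converges weakly in X to u ∈ X, then along a subsequence ∫_{ℝ^N} K(x) F(u_n(x)) dx → ∫_{ℝ^N} K(x) F(u(x)) dx and ∫_{ℝ^N} K(x) f(u_n(x)) u_n(x) dx → ∫_{ℝ^N} K(x) f(u(x)) u(x) dx. -/

import Mathlib

open MeasureTheory Filter

noncomputable section

namespace ZeroMass

/-- The ambient Euclidean space `ℝ^N`. -/
abbrev EN (N : ℕ) := EuclideanSpace ℝ (Fin N)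

/-- The critical fractional Sobolev exponent `2*_α = 2N/(N-2α)`. -/
def critExp (N : ℕ) (α : ℝ) : ℝ := 2 * N / (N - 2 * α)

/-- The square of the Gagliardo seminorm `[u]²`. -/
def gagSq (N : ℕ) (α : ℝ) (u : EN N → ℝ) : ENNReal :=
  ∫⁻ p : EN N × EN N, ENNReal.ofReal ((u p.1 - u p.2) ^ 2 / ‖p.1 - p.2‖ ^ ((N : ℝ) + 2 * α))

/-- The square of the full norm `‖u‖² = [u]² + ∫ V u²`. -/
def normSq {N : ℕ} (α : ℝ) (V : EN N → ℝ) (u : EN N → ℝ) : ENNReal :=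
  gagSq N α u + ∫⁻ x, ENNReal.ofReal (V x * u x ^ 2)

/-- Membership in the space `X`. -/
def memX {N : ℕ} (α : ℝ) (V : EN N → ℝ) (u : EN N → ℝ) : Prop :=
  Measurable u ∧ normSq α V u < ⊤

/-- The norm of `X`, i.e. `‖u‖ = ([u]² + ∫ V u²)^{1/2}`. -/
def Xnorm {N : ℕ} (α : ℝ) (V : EN N → ℝ) (u : EN N → ℝ) : ℝ :=
  ((normSq α V u).toReal) ^ (1 / 2 : ℝ)

/-- The primitive `F(t) = ∫₀ᵗ f(τ) dτ`. -/
def prim (f : ℝ → ℝ) (t : ℝ) : ℝ := ∫ τ in (0 : ℝ)..t, f τ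

/-- The energy functional `J`. -/
def Jfun {N : ℕ} (α : ℝ) (V K : EN N → ℝ) (f : ℝ → ℝ) (u : EN N → ℝ) : ℝ :=
  (1 / 2) * (normSq α V u).toReal - ∫ x, K x * prim f (u x)

/-- The pairing `⟨J'(u), φ⟩`. -/
def Jd {N : ℕ} (α : ℝ) (V K : EN N → ℝ) (f : ℝ → ℝ) (u φ : EN N → ℝ) : ℝ :=
  (∫ p : EN N × EN N, (u p.1 - u p.2) * (φ p.1 - φ p.2) / ‖p.1 - p.2‖ ^ ((N : ℝ) + 2 * α))
    + (∫ x, V x * u x * φ x) - ∫ x, K x * f (u x) * φ x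

/-- Positive part `u⁺ = max(u, 0)`. -/
def uplus {N : ℕ} (u : EN N → ℝ) : EN N → ℝ := fun x => max (u x) 0

/-- Negative part `u⁻ = min(u, 0)`. -/
def uminus {N : ℕ} (u : EN N → ℝ) : EN N → ℝ := fun x => min (u x) 0

/-- `u` is not almost everywhere zero. -/
def NotAEZero {N : ℕ} (u : EN N → ℝ) : Prop :=
  ¬ (u =ᵐ[(volume : Measure (EN N))] (0 : EN N → ℝ))

/-- Hypothesis (h1): `V, K > 0` everywhere and `K` bounded. -/
def H1 {N : ℕ} (V K : EN N → ℝ) : Prop :=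
  (∀ x, 0 < V x) ∧ (∀ x, 0 < K x) ∧ ∃ C : ℝ, ∀ x, K x ≤ C

/-- Hypothesis (h2): uniform vanishing of `∫_{A_n ∩ {|x| ≥ r}} K`. -/
def H2 {N : ℕ} (K : EN N → ℝ) : Prop :=
  ∀ (A : ℕ → Set (EN N)) (R : ℝ), 0 < R → (∀ n, MeasurableSet (A n)) →
    (∀ n, volume (A n) ≤ ENNReal.ofReal R) →
    ∀ ε : ℝ, 0 < ε → ∃ r₀ : ℝ, ∀ r : ℝ, r₀ ≤ r → ∀ n,
      (∫⁻ x in A n ∩ {x : EN N | r ≤ ‖x‖}, ENNReal.ofReal (K x)) ≤ ENNReal.ofReal ε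

/-- Hypothesis (h3): `K/V` is bounded. -/
def H3 {N : ℕ} (V K : EN N → ℝ) : Prop := ∃ C : ℝ, ∀ x, K x / V x ≤ C

/-- Hypothesis (h4) with exponent `m`. -/
def H4 {N : ℕ} (α : ℝ) (V K : EN N → ℝ) (m : ℝ) : Prop :=
  2 < m ∧ m < critExp N α ∧
    Tendsto (fun x : EN N => K x / V x ^ ((critExp N α - m) / (critExp N α - 2)))
      (comap (fun x : EN N => ‖x‖) atTop) (nhds 0)

/-- Hypothesis (f1): `f(t)/|t| → 0` as `t → 0`. -/
def Cf1 (f : ℝ → ℝ) : Prop :=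
  Tendsto (fun t : ℝ => f t / |t|) (nhdsWithin 0 {(0 : ℝ)}ᶜ) (nhds 0)

/-- Hypothesis (f̃1): `limsup_{t→0} f(t)/|t|^{m-1} < ∞`. -/
def Cf1' (f : ℝ → ℝ) (m : ℝ) : Prop :=
  ∃ C : ℝ, ∀ᶠ t in nhdsWithin (0 : ℝ) {(0 : ℝ)}ᶜ, f t / |t| ^ (m - 1) ≤ C

/-- Hypothesis (f2) with exponent `p`: `f(t)/|t|^{p-1} → 0` as `|t| → ∞`. -/
def Cf2 (f : ℝ → ℝ) (p : ℝ) : Prop :=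
  Tendsto (fun t : ℝ => f t / |t| ^ (p - 1)) (comap (fun t : ℝ => |t|) atTop) (nhds 0)

/-- Hypothesis (f3): `F(t)/t² → +∞` as `|t| → ∞`. -/
def Cf3 (f : ℝ → ℝ) : Prop :=
  Tendsto (fun t : ℝ => prim f t / t ^ 2) (comap (fun t : ℝ => |t|) atTop) atTop

/-- Hypothesis (f4): `t ↦ f(t)/|t|` is strictly increasing on `ℝ \ {0}`. -/
def Cf4 (f : ℝ → ℝ) : Prop :=
  ∀ s t : ℝ, s ≠ 0 → t ≠ 0 → s < t → f s / |s| < f t / |t|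

/-- Nehari manifold membership, formulated with the pairing `⟨J'(u), u⟩ = 0`. -/
def memNehari {N : ℕ} (α : ℝ) (V K : EN N → ℝ) (f : ℝ → ℝ) (u : EN N → ℝ) : Prop :=
  memX α V u ∧ NotAEZero u ∧ Jd α V K f u u = 0

/-- Nehari manifold membership, formulated as `‖u‖² = ∫ K f(u) u`. -/
def memNehari2 {N : ℕ} (α : ℝ) (V K : EN N → ℝ) (f : ℝ → ℝ) (u : EN N → ℝ) : Prop :=
  memX α V u ∧ NotAEZero u ∧ (normSq α V u).toReal = ∫ x, K x * f (u x) * u x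

/-- Nodal (sign-changing) Nehari set membership. -/
def memM {N : ℕ} (α : ℝ) (V K : EN N → ℝ) (f : ℝ → ℝ) (u : EN N → ℝ) : Prop :=
  memNehari α V K f u ∧ NotAEZero (uplus u) ∧ NotAEZero (uminus u) ∧
    Jd α V K f u (uplus u) = 0 ∧ Jd α V K f u (uminus u) = 0

/-- Weak convergence in `X` of the sequence `u` to `w`. -/
def weakConv {N : ℕ} (α : ℝ) (V : EN N → ℝ) (u : ℕ → EN N → ℝ) (w : EN N → ℝ) : Prop :=
  ∀ v : EN N → ℝ, memX α V v →
    Tendsto (fun n =>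
      (∫ p : EN N × EN N,
        ((u n p.1 - w p.1) - (u n p.2 - w p.2)) * (v p.1 - v p.2)
          / ‖p.1 - p.2‖ ^ ((N : ℝ) + 2 * α))
      + ∫ x, V x * (u n x - w x) * v x) atTop (nhds 0)

end ZeroMass

open ZeroMass

namespace ZeroMass

open ENNReal Metric Topology

lemma ofReal_sq_sub_setAverage_le {X : Type*} [MeasurableSpace X] {μ : Measure X} {s : Set X}
    (hs0 : μ s ≠ 0) (hs : μ s ≠ ⊤) {g : X → ℝ} (hg : IntegrableOn g s μ) (a : ℝ) :
    ENNReal.ofReal ((a - ⨍ y in s, g y ∂μ) ^ 2) ≤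
      (μ s)⁻¹ * ∫⁻ y in s, ENNReal.ofReal ((a - g y) ^ 2) ∂μ := by
  by_cases htop : ∫⁻ y in s, ENNReal.ofReal ((a - g y) ^ 2) ∂μ = ⊤
  · rw [htop, ENNReal.mul_top (ENNReal.inv_ne_zero.2 hs)]
    exact le_top
  have hc : Integrable (fun _ => a) (μ.restrict s) := integrableOn_const hs
  have hsub : IntegrableOn (fun y => a - g y) s μ := hc.sub hg
  have hsq : IntegrableOn (fun y => (a - g y) ^ 2) s μ := by
    refine ⟨hsub.aestronglyMeasurable.pow 2, ?_⟩
    rw [hasFiniteIntegral_iff_ofReal (Eventually.of_forall fun y => sq_nonneg _)]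
    exact Ne.lt_top htop
  have hav : ⨍ y in s, (a - g y) ∂μ = a - ⨍ y in s, g y ∂μ := by
    have h0 : μ.real s ≠ 0 := (ENNReal.toReal_pos hs0 hs).ne'
    rw [setAverage_eq, setAverage_eq, integral_sub hc hg, setIntegral_const]
    simp only [smul_eq_mul]
    field_simp
  have hconv := ConvexOn.map_set_average_le (s := Set.univ) (g := fun z : ℝ => z ^ 2)
    (even_two.convexOn_pow) (by fun_prop) isClosed_univ hs0 hs (by simp) hsub hsq
  rw [← hav]
  refine (ENNReal.ofReal_le_ofReal hconv).trans_eq ?_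
  rw [ofReal_setAverage hsq (Eventually.of_forall fun y => sq_nonneg _), div_eq_mul_inv, mul_comm]

section Averages

variable {N : ℕ} {α : ℝ} {u : EN N → ℝ}

/-- The inner integral `∫ |u(x)-u(y)|²/|x-y|^(N+2α) dy` of the Gagliardo seminorm. -/
def gagDens (α : ℝ) (u : EN N → ℝ) (x : EN N) : ENNReal :=
  ∫⁻ y, ENNReal.ofReal ((u x - u y) ^ 2 / ‖x - y‖ ^ ((N : ℝ) + 2 * α))

lemma measurable_gagKernel (hu : Measurable u) : Measurable fun p : EN N × EN N =>
    ENNReal.ofReal ((u p.1 - u p.2) ^ 2 / ‖p.1 - p.2‖ ^ ((N : ℝ) + 2 * α)) := by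
  fun_prop

lemma measurable_gagDens (hu : Measurable u) : Measurable (gagDens α u) :=
  (measurable_gagKernel hu).lintegral_prod_right'

lemma lintegral_gagDens (hu : Measurable u) : ∫⁻ x, gagDens α u x = gagSq N α u := by
  rw [gagSq, Measure.volume_eq_prod, lintegral_prod _ (measurable_gagKernel hu).aemeasurable]
  rfl

lemma ofReal_sq_sub_setAverage_le_gagDens (hκ : 0 ≤ (N : ℝ) + 2 * α)
    {t : Set (EN N)} {x : EN N} {ρ : ℝ} (ht : MeasurableSet t) (ht0 : volume t ≠ 0)
    (ht1 : volume t ≠ ⊤) (hut : IntegrableOn u t) (hsub : t ⊆ closedBall x ρ) :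
    ENNReal.ofReal ((u x - ⨍ y in t, u y) ^ 2) ≤
      (volume t)⁻¹ * (ENNReal.ofReal (ρ ^ ((N : ℝ) + 2 * α)) * gagDens α u x) := by
  refine (ofReal_sq_sub_setAverage_le ht0 ht1 hut _).trans ?_
  gcongr
  rw [gagDens, ← lintegral_const_mul' _ _ ENNReal.ofReal_ne_top]
  refine le_trans ?_ (setLIntegral_le_lintegral t _)
  refine setLIntegral_mono' ht fun y hy => ?_
  rcases eq_or_ne x y with rfl | hxy
  · simp
  have hpos : 0 < ‖x - y‖ := norm_pos_iff.2 (sub_ne_zero.2 hxy)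
  have hle : ‖x - y‖ ≤ ρ := by
    have := hsub hy
    rwa [mem_closedBall, dist_comm, dist_eq_norm] at this
  rw [← ENNReal.ofReal_mul (by have := hpos.le.trans hle; positivity)]
  apply ENNReal.ofReal_le_ofReal
  have h1 : ‖x - y‖ ^ ((N : ℝ) + 2 * α) ≤ ρ ^ ((N : ℝ) + 2 * α) :=
    Real.rpow_le_rpow hpos.le hle hκ
  have h2 : 0 < ‖x - y‖ ^ ((N : ℝ) + 2 * α) := Real.rpow_pos_of_pos hpos _
  rw [mul_div_assoc', le_div_iff₀ h2, mul_comm]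
  gcongr

lemma ofReal_sq_setAverage_sub_le_gagSq (hκ : 0 ≤ (N : ℝ) + 2 * α) (hu : Measurable u)
    {s t : Set (EN N)} {ρ : ℝ} (hs : MeasurableSet s) (ht : MeasurableSet t)
    (hs0 : volume s ≠ 0) (hs1 : volume s ≠ ⊤) (ht0 : volume t ≠ 0)
    (ht1 : volume t ≠ ⊤) (hus : IntegrableOn u s) (hut : IntegrableOn u t)
    (hsub : ∀ x ∈ s, t ⊆ closedBall x ρ) :
    ENNReal.ofReal (((⨍ y in s, u y) - ⨍ y in t, u y) ^ 2) ≤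
      (volume s)⁻¹ * ((volume t)⁻¹ * (ENNReal.ofReal (ρ ^ ((N : ℝ) + 2 * α)) * gagSq N α u)) := by
  rw [← neg_sub, neg_sq]
  refine (ofReal_sq_sub_setAverage_le hs0 hs1 hus _).trans ?_
  gcongr
  have hc : (volume t)⁻¹ ≠ ⊤ := ENNReal.inv_ne_top.2 ht0
  rw [← lintegral_gagDens hu, ← lintegral_const_mul' _ _ ENNReal.ofReal_ne_top,
    ← lintegral_const_mul' _ _ hc]
  refine le_trans ?_ (setLIntegral_le_lintegral s _)
  refine setLIntegral_mono' hs fun x hx => ?_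
  rw [← neg_sub, neg_sq]
  exact ofReal_sq_sub_setAverage_le_gagDens hκ ht ht0 ht1 hut (hsub x hx)

end Averages

section BallAverages

variable {N : ℕ} {α : ℝ} {u : EN N → ℝ}

/-- The average of `u` over the ball of radius `r` around `x`. -/
def ballAvg (u : EN N → ℝ) (r : ℝ) (x : EN N) : ℝ := ⨍ y in ball x r, u y

/-- The volume of the unit ball of `ℝ^N`. -/
def unitVol (N : ℕ) : ℝ := volume.real (ball (0 : EN N) 1)

lemma unitVol_pos (N : ℕ) : 0 < unitVol N :=
  ENNReal.toReal_pos (measure_ball_pos _ _ one_pos).ne' measure_ball_lt_top.ne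

lemma volume_ball_eq (x : EN N) {r : ℝ} (hr : 0 < r) :
    volume (ball x r) = ENNReal.ofReal (unitVol N * r ^ N) := by
  rw [Measure.addHaar_ball_of_pos _ _ hr, mul_comm (unitVol N), ENNReal.ofReal_mul (by positivity),
    unitVol, Measure.real, ENNReal.ofReal_toReal measure_ball_lt_top.ne]
  simp

lemma integrableOn_ball (hu : LocallyIntegrable u) (x : EN N) (r : ℝ) :
    IntegrableOn u (ball x r) :=
  (hu.integrableOn_isCompact (isCompact_closedBall x r)).mono_set ball_subset_closedBall

lemma ofReal_sq_sub_ballAvg_le (hκ : 0 ≤ (N : ℝ) + 2 * α) (hloc : LocallyIntegrable u)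
    {r : ℝ} (hr : 0 < r) (x : EN N) :
    ENNReal.ofReal ((u x - ballAvg u r x) ^ 2) ≤
      ENNReal.ofReal ((unitVol N)⁻¹ * r ^ (2 * α)) * gagDens α u x := by
  have hω := unitVol_pos N
  refine (ofReal_sq_sub_setAverage_le_gagDens hκ measurableSet_ball
    (measure_ball_pos _ _ hr).ne' measure_ball_lt_top.ne (integrableOn_ball hloc x r)
    ball_subset_closedBall).trans_eq ?_
  rw [volume_ball_eq x hr, ← ENNReal.ofReal_inv_of_pos (by positivity), ← mul_assoc,
    ← ENNReal.ofReal_mul (by positivity), Real.rpow_add hr, Real.rpow_natCast]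
  congr 2
  field_simp

lemma sq_ballAvg_sub_le (hκ : 0 ≤ (N : ℝ) + 2 * α) (hu : Measurable u)
    (hloc : LocallyIntegrable u) {M : ℝ} (hM : 0 ≤ M) (huM : gagSq N α u ≤ ENNReal.ofReal M)
    {a b ρ : ℝ} (ha : 0 < a) (hb : 0 < b) {x y : EN N} (hρ : a + b + dist x y ≤ ρ) :
    (ballAvg u a x - ballAvg u b y) ^ 2 ≤
      (unitVol N)⁻¹ ^ 2 * (a ^ N)⁻¹ * (b ^ N)⁻¹ * ρ ^ ((N : ℝ) + 2 * α) * M := by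
  have hω := unitVol_pos N
  have hρ0 : 0 ≤ ρ := le_trans (by positivity) hρ
  rw [← ENNReal.ofReal_le_ofReal_iff (by positivity)]
  refine (ofReal_sq_setAverage_sub_le_gagSq (ρ := ρ) hκ hu measurableSet_ball measurableSet_ball
    (measure_ball_pos _ _ ha).ne' measure_ball_lt_top.ne
    (measure_ball_pos _ _ hb).ne' measure_ball_lt_top.ne (integrableOn_ball hloc x a)
    (integrableOn_ball hloc y b) ?_).trans ?_
  · intro x' hx' y' hy'
    rw [mem_ball] at hx' hy'
    rw [mem_closedBall]
    have h1 := dist_triangle4 y' y x x'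
    rw [dist_comm y x, dist_comm x x'] at h1
    linarith
  · rw [volume_ball_eq x ha, volume_ball_eq y hb, ← ENNReal.ofReal_inv_of_pos (by positivity),
      ← ENNReal.ofReal_inv_of_pos (by positivity)]
    refine (mul_le_mul_right (mul_le_mul_right (mul_le_mul_right huM _) _) _).trans_eq ?_
    rw [← ENNReal.ofReal_mul (by positivity), ← ENNReal.ofReal_mul (by positivity),
      ← ENNReal.ofReal_mul (by positivity)]
    congr 1
    field_simp

lemma sq_ballAvg_sub_double_le (hκ : 0 ≤ (N : ℝ) + 2 * α) (hu : Measurable u)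
    (hloc : LocallyIntegrable u) {M : ℝ} (hM : 0 ≤ M) (huM : gagSq N α u ≤ ENNReal.ofReal M)
    {r : ℝ} (hr : 0 < r) (x : EN N) :
    (ballAvg u r x - ballAvg u (2 * r) x) ^ 2 ≤
      (unitVol N)⁻¹ ^ 2 * (2 ^ N)⁻¹ * 3 ^ ((N : ℝ) + 2 * α) * r ^ (2 * α - N) * M := by
  refine (sq_ballAvg_sub_le (ρ := 3 * r) hκ hu hloc hM huM hr (by positivity)
    (by rw [dist_self]; linarith)).trans_eq ?_
  have h3 : (3 * r) ^ ((N : ℝ) + 2 * α) = 3 ^ ((N : ℝ) + 2 * α) * (r ^ N * r ^ N) *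
      r ^ (2 * α - N) := by
    rw [Real.mul_rpow (by norm_num) hr.le, mul_assoc, ← pow_add, ← Real.rpow_natCast,
      ← Real.rpow_add hr]
    congr 2
    push_cast
    ring
  rw [h3, mul_pow]
  field_simp

lemma tendsto_ballAvg_sub (hα : 0 ≤ (N : ℝ) + 2 * α) (hN : 2 * α < N) (hu : Measurable u)
    (hloc : LocallyIntegrable u) (hfin : gagSq N α u ≠ ⊤)
    {r : ℝ} (hr : 0 < r) (x : EN N) :
    Tendsto (fun k : ℕ => ballAvg u (2 ^ k * r) x - ballAvg u (2 ^ k) 0) atTop (𝓝 0) := by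
  have hω := unitVol_pos N
  set M := (gagSq N α u).toReal with hMdef
  have hM : 0 ≤ M := ENNReal.toReal_nonneg
  have huM : gagSq N α u ≤ ENNReal.ofReal M := by rw [hMdef, ENNReal.ofReal_toReal hfin]
  set B : ℝ := (unitVol N)⁻¹ ^ 2 * (r ^ N)⁻¹ * (r + 1 + ‖x‖) ^ ((N : ℝ) + 2 * α) * M with hB
  have hkey : ∀ k : ℕ, (ballAvg u (2 ^ k * r) x - ballAvg u (2 ^ k) 0) ^ 2 ≤
      B * ((2 : ℝ) ^ (2 * α - N)) ^ k := by
    intro k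
    have h2k : (1 : ℝ) ≤ 2 ^ k := one_le_pow₀ (by norm_num)
    have h2k0 : (0 : ℝ) < 2 ^ k := by positivity
    refine (sq_ballAvg_sub_le (ρ := 2 ^ k * (r + 1 + ‖x‖)) hα hu hloc hM huM (by positivity)
      (by positivity) ?_).trans_eq ?_
    · rw [dist_zero_right]
      nlinarith [norm_nonneg x]
    · have h3 : ((2 : ℝ) ^ k * (r + 1 + ‖x‖)) ^ ((N : ℝ) + 2 * α) =
          (r + 1 + ‖x‖) ^ ((N : ℝ) + 2 * α) * ((2 ^ k) ^ N * (2 ^ k) ^ N) *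
            ((2 : ℝ) ^ (2 * α - N)) ^ k := by
        rw [Real.mul_rpow h2k0.le (by positivity), mul_comm, mul_assoc, ← pow_add,
          ← Real.rpow_natCast (_ ^ (_ : ℝ)) k, ← Real.rpow_mul (by norm_num),
          mul_comm _ (k : ℝ), Real.rpow_mul (by norm_num), Real.rpow_natCast 2 k,
          ← Real.rpow_natCast (2 ^ k), ← Real.rpow_add h2k0]
        congr 2
        push_cast
        ring
      rw [h3, mul_pow, hB]
      field_simp
  have hq : (2 : ℝ) ^ (2 * α - N) < 1 := Real.rpow_lt_one_of_one_lt_of_neg (by norm_num)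
    (by linarith)
  have hlim : Tendsto (fun k : ℕ => B * ((2 : ℝ) ^ (2 * α - N)) ^ k) atTop (𝓝 0) := by
    simpa using (tendsto_pow_atTop_nhds_zero_of_lt_one (by positivity) hq).const_mul B
  have hsq := squeeze_zero (fun k => sq_nonneg _) hkey hlim
  have := hsq.sqrt
  simp only [Real.sqrt_sq_eq_abs, Real.sqrt_zero] at this
  exact (tendsto_zero_iff_abs_tendsto_zero _).2 this

/-- The constant in `exists_sq_ballAvg_sub_le`. -/
def avgConst (N : ℕ) (α : ℝ) : ℝ :=
  (unitVol N)⁻¹ ^ 2 * (2 ^ N)⁻¹ * 3 ^ ((N : ℝ) + 2 * α) / (1 - 2 ^ ((2 * α - N) / 2)) ^ 2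

lemma avgConst_nonneg (N : ℕ) (α : ℝ) : 0 ≤ avgConst N α := by
  have := unitVol_pos N
  unfold avgConst
  positivity

/-- A function with finite Gagliardo seminorm has a limiting mean value `c` at infinity. -/
lemma exists_sq_ballAvg_sub_le (hα : 0 ≤ (N : ℝ) + 2 * α) (hN : 2 * α < N) (hu : Measurable u)
    (hloc : LocallyIntegrable u) {M : ℝ} (hM : 0 ≤ M) (huM : gagSq N α u ≤ ENNReal.ofReal M) :
    ∃ c : ℝ, ∀ (x : EN N) (r : ℝ), 0 < r →
      (ballAvg u r x - c) ^ 2 ≤ avgConst N α * r ^ (2 * α - N) * M := by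
  have hω := unitVol_pos N
  set q : ℝ := 2 ^ ((2 * α - N) / 2) with hq
  have hq1 : q < 1 := Real.rpow_lt_one_of_one_lt_of_neg (by norm_num) (by linarith)
  have hq0 : 0 < q := by positivity
  set C₁ : ℝ := (unitVol N)⁻¹ ^ 2 * (2 ^ N)⁻¹ * 3 ^ ((N : ℝ) + 2 * α) with hC₁
  have hC₁0 : 0 ≤ C₁ := by positivity
  have hstep : ∀ (x : EN N) (r : ℝ), 0 < r → ∀ k : ℕ,
      dist (ballAvg u (2 ^ k * r) x) (ballAvg u (2 ^ (k + 1) * r) x) ≤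
        √(C₁ * r ^ (2 * α - N) * M) * q ^ k := by
    intro x r hr k
    have h := sq_ballAvg_sub_double_le hα hu hloc hM huM (r := 2 ^ k * r) (by positivity) x
    rw [← mul_assoc 2, ← pow_succ'] at h
    rw [Real.dist_eq]
    apply abs_le_of_sq_le_sq _ (by positivity)
    rw [mul_pow, Real.sq_sqrt (by positivity)]
    refine h.trans_eq ?_
    rw [Real.mul_rpow (by positivity) hr.le]
    have : ((2 : ℝ) ^ k) ^ (2 * α - N) = (q ^ k) ^ 2 := by
      rw [hq, ← pow_mul, ← Real.rpow_natCast (_ ^ (_ : ℝ)), ← Real.rpow_natCast 2 k,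
        ← Real.rpow_mul (by norm_num), ← Real.rpow_mul (by norm_num)]
      congr 1
      push_cast
      ring
    rw [this]
    ring
  obtain ⟨c, hc⟩ := cauchySeq_tendsto_of_complete
    (cauchySeq_of_le_geometric _ _ hq1 (hstep 0 1 one_pos))
  refine ⟨c, fun x r hr => ?_⟩
  have hlim : Tendsto (fun k : ℕ => ballAvg u (2 ^ k * r) x) atTop (𝓝 c) := by
    have := (tendsto_ballAvg_sub hα hN hu hloc (ne_top_of_le_ne_top ENNReal.ofReal_ne_top huM)
      hr x).add hc
    simpa using this
  have hd := dist_le_of_le_geometric_of_tendsto₀ _ _ hq1 (hstep x r hr) hlim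
  rw [pow_zero, one_mul, Real.dist_eq] at hd
  rw [← sq_abs]
  refine (pow_le_pow_left₀ (abs_nonneg _) hd 2).trans_eq ?_
  rw [div_pow, Real.sq_sqrt (by positivity), avgConst]
  ring

end BallAverages

section Sobolev

variable {N : ℕ} {α : ℝ} {V u : EN N → ℝ}

lemma critExp_pos (hα : 0 < α) (hN : 2 * α < N) : 0 < critExp N α := by
  have h1 : 0 < (N : ℝ) - 2 * α := by linarith
  have h2 : (0 : ℝ) < N := by linarith
  unfold critExp
  positivity

lemma two_lt_critExp (hα : 0 < α) (hN : 2 * α < N) : 2 < critExp N α := by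
  have h1 : 0 < (N : ℝ) - 2 * α := by linarith
  rw [critExp, lt_div_iff₀ h1]
  linarith

/-- The constant in the pointwise fractional Sobolev estimate. -/
def sobConst (N : ℕ) (α M : ℝ) : ℝ :=
  (2 * (unitVol N)⁻¹ + 2 * (avgConst N α * M)) ^ (critExp N α / 2)

lemma sobConst_nonneg (N : ℕ) (α : ℝ) {M : ℝ} (hM : 0 ≤ M) : 0 ≤ sobConst N α M := by
  have := unitVol_pos N
  have := avgConst_nonneg N α
  unfold sobConst
  positivity

lemma rpow_abs_sub_le (hα : 0 < α) (hN : 2 * α < N)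
    (hloc : LocallyIntegrable u) {M : ℝ} (hM : 0 ≤ M) {c : ℝ}
    (hc : ∀ (x : EN N) (r : ℝ), 0 < r →
      (ballAvg u r x - c) ^ 2 ≤ avgConst N α * r ^ (2 * α - N) * M)
    {x : EN N} (hx : gagDens α u x ≠ ⊤) :
    |u x - c| ^ critExp N α ≤ sobConst N α M * (gagDens α u x).toReal := by
  have hω := unitVol_pos N
  have hav := avgConst_nonneg N α
  have hN0 : (0 : ℝ) < N := by linarith
  have hN2 : 0 < (N : ℝ) - 2 * α := by linarith
  have hq := critExp_pos hα hN
  set D := (gagDens α u x).toReal with hD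
  have hD0 : 0 ≤ D := ENNReal.toReal_nonneg
  have key : ∀ D', D < D' → |u x - c| ^ critExp N α ≤ sobConst N α M * D' := by
    intro D' hD'
    have hpos : 0 < D' := hD0.trans_lt hD'
    set r : ℝ := D' ^ (-(1 / (N : ℝ))) with hr
    have hr0 : 0 < r := by positivity
    have h1 : (u x - ballAvg u r x) ^ 2 ≤ (unitVol N)⁻¹ * r ^ (2 * α) * D' := by
      rw [← ENNReal.ofReal_le_ofReal_iff (by positivity)]
      refine (ofReal_sq_sub_ballAvg_le (by positivity) hloc hr0 x).trans ?_
      rw [ENNReal.ofReal_mul (p := (unitVol N)⁻¹ * r ^ (2 * α)) (by positivity)]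
      gcongr
      rw [← ENNReal.ofReal_toReal hx]
      exact ENNReal.ofReal_le_ofReal hD'.le
    have h2 := hc x r hr0
    have e1 : r ^ (2 * α) * D' = D' ^ (1 - 2 * α / N) := by
      rw [hr, ← Real.rpow_mul hpos.le]
      nth_rewrite 2 [← Real.rpow_one D']
      rw [← Real.rpow_add hpos]
      congr 1
      field_simp
      ring
    have e2 : r ^ (2 * α - N) = D' ^ (1 - 2 * α / N) := by
      rw [hr, ← Real.rpow_mul hpos.le]
      congr 1
      field_simp
      ring
    have h3 : (u x - c) ^ 2 ≤
        (2 * (unitVol N)⁻¹ + 2 * (avgConst N α * M)) * D' ^ (1 - 2 * α / N) := by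
      rw [mul_assoc, e1] at h1
      rw [e2] at h2
      nlinarith [sq_nonneg ((u x - ballAvg u r x) - (ballAvg u r x - c))]
    calc |u x - c| ^ critExp N α = ((u x - c) ^ 2) ^ (critExp N α / 2) := by
          rw [← sq_abs, ← Real.rpow_natCast, ← Real.rpow_mul (abs_nonneg _)]
          congr 1
          push_cast
          ring
      _ ≤ ((2 * (unitVol N)⁻¹ + 2 * (avgConst N α * M)) * D' ^ (1 - 2 * α / N)) ^
          (critExp N α / 2) := by gcongr
      _ = sobConst N α M * D' := by
          rw [Real.mul_rpow (by positivity) (by positivity), ← Real.rpow_mul hpos.le, sobConst]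
          congr 1
          nth_rewrite 2 [← Real.rpow_one D']
          congr 1
          rw [critExp]
          field_simp
  have hlim : Tendsto (fun D' => sobConst N α M * D') (𝓝[>] D) (𝓝 (sobConst N α M * D)) :=
    ((continuous_const.mul continuous_id).tendsto D).mono_left nhdsWithin_le_nhds
  exact ge_of_tendsto hlim (eventually_nhdsWithin_of_forall key)

/-- Fractional Sobolev inequality, modulo the mean value `c` at infinity. -/
lemma lintegral_rpow_abs_sub_le (hα : 0 < α) (hN : 2 * α < N) (hu : Measurable u)
    (hloc : LocallyIntegrable u) {M : ℝ} (hM : 0 ≤ M) (huM : gagSq N α u ≤ ENNReal.ofReal M)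
    {c : ℝ} (hc : ∀ (x : EN N) (r : ℝ), 0 < r →
      (ballAvg u r x - c) ^ 2 ≤ avgConst N α * r ^ (2 * α - N) * M) :
    ∫⁻ x, ENNReal.ofReal (|u x - c| ^ critExp N α) ≤ ENNReal.ofReal (sobConst N α M * M) := by
  have hfin : ∀ᵐ x, gagDens α u x < ⊤ := by
    refine ae_lt_top (measurable_gagDens hu) ?_
    rw [lintegral_gagDens hu]
    exact ne_top_of_le_ne_top ENNReal.ofReal_ne_top huM
  calc ∫⁻ x, ENNReal.ofReal (|u x - c| ^ critExp N α)
      ≤ ∫⁻ x, ENNReal.ofReal (sobConst N α M) * gagDens α u x := by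
        refine lintegral_mono_ae ?_
        filter_upwards [hfin] with x hx
        rw [← ENNReal.ofReal_toReal hx.ne, ← ENNReal.ofReal_mul (sobConst_nonneg N α hM)]
        exact ENNReal.ofReal_le_ofReal (rpow_abs_sub_le hα hN hloc hM hc hx.ne)
    _ ≤ ENNReal.ofReal (sobConst N α M * M) := by
        rw [lintegral_const_mul' _ _ ENNReal.ofReal_ne_top, lintegral_gagDens hu,
          ENNReal.ofReal_mul (sobConst_nonneg N α hM)]
        gcongr

lemma exists_pos_le_of_isCompact (hV : Continuous V) (hV0 : ∀ x, 0 < V x) {k : Set (EN N)}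
    (hk : IsCompact k) : ∃ m, 0 < m ∧ ∀ x ∈ k, m ≤ V x := by
  rcases k.eq_empty_or_nonempty with rfl | hne
  · exact ⟨1, one_pos, by simp⟩
  · obtain ⟨x₀, -, hx₀⟩ := hk.exists_isMinOn hne hV.continuousOn
    exact ⟨V x₀, hV0 x₀, fun x hx => hx₀ hx⟩

lemma setLIntegral_sq_le {k : Set (EN N)} (hk : MeasurableSet k) {m : ℝ} (hm : 0 < m)
    (hmV : ∀ x ∈ k, m ≤ V x) :
    ∫⁻ x in k, ENNReal.ofReal (u x ^ 2) ≤ ENNReal.ofReal m⁻¹ * normSq α V u := by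
  calc ∫⁻ x in k, ENNReal.ofReal (u x ^ 2)
      ≤ ∫⁻ x in k, ENNReal.ofReal m⁻¹ * ENNReal.ofReal (V x * u x ^ 2) := by
        refine setLIntegral_mono' hk fun x hx => ?_
        rw [← ENNReal.ofReal_mul (by positivity)]
        apply ENNReal.ofReal_le_ofReal
        rw [← div_eq_inv_mul, le_div_iff₀ hm, mul_comm]
        gcongr
        exact hmV x hx
    _ ≤ ∫⁻ x, ENNReal.ofReal m⁻¹ * ENNReal.ofReal (V x * u x ^ 2) :=
        setLIntegral_le_lintegral _ _
    _ ≤ _ := by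
        rw [lintegral_const_mul' _ _ ENNReal.ofReal_ne_top]
        gcongr
        exact le_add_self

lemma locallyIntegrable_of_memX (hV : Continuous V) (hV0 : ∀ x, 0 < V x) (hu : memX α V u) :
    LocallyIntegrable u := by
  rw [locallyIntegrable_iff]
  intro k hk
  obtain ⟨m, hm, hmV⟩ := exists_pos_le_of_isCompact hV hV0 hk
  have hk' : IsFiniteMeasure (volume.restrict k) := ⟨by simpa using hk.measure_lt_top⟩
  have hL2 : MemLp u 2 (volume.restrict k) := by
    refine (memLp_two_iff_integrable_sq hu.1.aestronglyMeasurable).2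
      ⟨(hu.1.pow_const 2).aestronglyMeasurable, ?_⟩
    rw [hasFiniteIntegral_iff_ofReal (Eventually.of_forall fun y => sq_nonneg _)]
    exact (setLIntegral_sq_le (α := α) hk.measurableSet hm hmV).trans_lt
      (ENNReal.mul_lt_top ENNReal.ofReal_lt_top hu.2)
  exact hL2.integrable (by norm_num)

/-- Every `u` in a bounded set of `X` splits as a bounded constant plus a function bounded in
`L^{2*}`, and its averages stay close to that constant. -/
lemma exists_sobolev_decomposition (hα : 0 < α) (hN : 2 * α < N) (hV : Continuous V)
    (hV0 : ∀ x, 0 < V x) {M : ℝ} (hM : 0 ≤ M) :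
    ∃ C : ℝ, 0 ≤ C ∧ ∀ u : EN N → ℝ, Measurable u → normSq α V u ≤ ENNReal.ofReal M →
      ∃ c : ℝ, c ^ 2 ≤ C ∧
        ∫⁻ x, ENNReal.ofReal (|u x - c| ^ critExp N α) ≤ ENNReal.ofReal C ∧
        ∀ (x : EN N) (r : ℝ), 0 < r → (ballAvg u r x - c) ^ 2 ≤ C * r ^ (2 * α - N) := by
  have hω := unitVol_pos N
  have hav := avgConst_nonneg N α
  have hS := sobConst_nonneg N α hM
  obtain ⟨m, hm, hmV⟩ := exists_pos_le_of_isCompact hV hV0 (isCompact_closedBall (0 : EN N) 1)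
  set a := avgConst N α * M with ha
  have ha0 : 0 ≤ a := by positivity
  set b := (unitVol N)⁻¹ * (m⁻¹ * M) with hb
  have hb0 : 0 ≤ b := by positivity
  have hs0 : 0 ≤ sobConst N α M * M := by positivity
  refine ⟨2 * b + 2 * a + sobConst N α M * M, by positivity, fun u hu huM => ?_⟩
  have hloc := locallyIntegrable_of_memX hV hV0 ⟨hu, huM.trans_lt ENNReal.ofReal_lt_top⟩
  have hgag : gagSq N α u ≤ ENNReal.ofReal M := le_self_add.trans huM
  obtain ⟨c, hc⟩ := exists_sq_ballAvg_sub_le (by positivity) hN hu hloc hM hgag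
  refine ⟨c, ?_, ?_, ?_⟩
  · have h1 : (ballAvg u 1 0) ^ 2 ≤ b := by
      rw [← ENNReal.ofReal_le_ofReal_iff hb0]
      have h := ofReal_sq_sub_setAverage_le (measure_ball_pos volume (0 : EN N) one_pos).ne'
        measure_ball_lt_top.ne (integrableOn_ball hloc 0 1) 0
      simp only [zero_sub, neg_sq] at h
      refine h.trans ?_
      rw [volume_ball_eq 0 one_pos, one_pow, mul_one, ← ENNReal.ofReal_inv_of_pos hω, hb,
        ENNReal.ofReal_mul (by positivity), ENNReal.ofReal_mul (by positivity)]
      gcongr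
      refine (setLIntegral_sq_le (α := α) measurableSet_ball hm
        fun x hx => hmV x (ball_subset_closedBall hx)).trans ?_
      gcongr
    have h2 := hc 0 1 one_pos
    rw [Real.one_rpow, mul_one, ← ha] at h2
    nlinarith [sq_nonneg (ballAvg u 1 0 + (ballAvg u 1 0 - c))]
  · refine (lintegral_rpow_abs_sub_le hα hN hu hloc hM hgag hc).trans ?_
    exact ENNReal.ofReal_le_ofReal (by linarith)
  · intro x r hr
    refine (hc x r hr).trans ?_
    rw [mul_assoc, mul_comm (r ^ _), ← mul_assoc, ← ha]
    gcongr
    linarith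

end Sobolev

/-- A bounded sequence in a set `T` of a Hilbert space which converges weakly to `0` when tested
against `T` converges weakly to `0`. -/
lemma tendsto_inner_zero_of_forall_mem {H : Type*} [NormedAddCommGroup H] [InnerProductSpace ℝ H]
    [CompleteSpace H] {T : Set H} {z : ℕ → H} (hz : ∀ n, z n ∈ T) {B : ℝ} (hB : ∀ n, ‖z n‖ ≤ B)
    (h : ∀ t ∈ T, Tendsto (fun n => inner ℝ (z n) t) atTop (𝓝 0)) (g : H) :
    Tendsto (fun n => inner ℝ (z n) g) atTop (𝓝 0) := by
  set S := Submodule.span ℝ T with hS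
  have hspan : ∀ t ∈ S, Tendsto (fun n => inner ℝ (z n) t) atTop (𝓝 0) := by
    intro t ht
    induction ht using Submodule.span_induction with
    | mem x hx => exact h x hx
    | zero => simp
    | add x y _ _ hx hy => simpa [inner_add_right] using hx.add hy
    | smul a x _ hx => simpa [inner_smul_right] using hx.const_mul a
  have : CompleteSpace S.topologicalClosure := S.isClosed_topologicalClosure.completeSpace_coe
  obtain ⟨p, hp, o, ho, rfl⟩ := Submodule.exists_add_mem_mem_orthogonal
    (K := S.topologicalClosure) g
  have hzo : ∀ n, inner ℝ (z n) o = 0 := fun n =>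
    Submodule.inner_right_of_mem_orthogonal
      (S.le_topologicalClosure (Submodule.subset_span (hz n))) ho
  simp only [inner_add_right, hzo, add_zero]
  have hB0 : 0 ≤ B := (norm_nonneg _).trans (hB 0)
  rw [Metric.tendsto_atTop]
  intro ε hε
  have hp' : p ∈ closure (S : Set H) := by
    rwa [← Submodule.topologicalClosure_coe]
  obtain ⟨s, hs, hps⟩ := Metric.mem_closure_iff.1 hp' (ε / (2 * (B + 1))) (by positivity)
  obtain ⟨n₀, hn₀⟩ := Metric.tendsto_atTop.1 (hspan s hs) (ε / 2) (by positivity)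
  refine ⟨n₀, fun n hn => ?_⟩
  have h1 := hn₀ n hn
  rw [dist_zero_right] at h1 ⊢
  have h2 : ‖inner ℝ (z n) (p - s)‖ ≤ B * (ε / (2 * (B + 1))) := by
    refine (norm_inner_le_norm _ _).trans ?_
    rw [dist_eq_norm] at hps
    gcongr
    exact hB n
  have h3 : B * (ε / (2 * (B + 1))) ≤ ε / 2 := by
    rw [mul_div_assoc', div_le_div_iff₀ (by positivity) (by positivity)]
    nlinarith
  have h4 : inner ℝ (z n) p = inner ℝ (z n) s + inner ℝ (z n) (p - s) := by
    rw [← inner_add_right, add_sub_cancel]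
  rw [h4]
  exact (norm_add_le _ _).trans_lt (by linarith)

section Embedding

variable {N : ℕ} {α : ℝ} {V : EN N → ℝ}

/-- The fractional difference quotient of `u`. -/
def diffQuot (α : ℝ) {N : ℕ} (u : EN N → ℝ) (p : EN N × EN N) : ℝ :=
  (u p.1 - u p.2) / ‖p.1 - p.2‖ ^ (((N : ℝ) + 2 * α) / 2)

lemma diffQuot_mul (u v : EN N → ℝ) (p : EN N × EN N) :
    diffQuot α u p * diffQuot α v p =
      (u p.1 - u p.2) * (v p.1 - v p.2) / ‖p.1 - p.2‖ ^ ((N : ℝ) + 2 * α) := by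
  have h : ‖p.1 - p.2‖ ^ ((N : ℝ) + 2 * α) = (‖p.1 - p.2‖ ^ (((N : ℝ) + 2 * α) / 2)) *
      (‖p.1 - p.2‖ ^ (((N : ℝ) + 2 * α) / 2)) := by
    rw [← sq, ← Real.rpow_natCast, ← Real.rpow_mul (norm_nonneg _)]
    congr 1
    push_cast
    ring
  rw [diffQuot, diffQuot, h, div_mul_div_comm]

lemma memLp_diffQuot {u : EN N → ℝ} (hu : Measurable u) (hfin : gagSq N α u < ⊤) :
    MemLp (diffQuot α u) 2 := by
  have hm : Measurable (diffQuot α u) := by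
    unfold diffQuot
    fun_prop
  refine (memLp_two_iff_integrable_sq hm.aestronglyMeasurable).2
    ⟨(hm.pow_const 2).aestronglyMeasurable, ?_⟩
  rw [hasFiniteIntegral_iff_ofReal (Eventually.of_forall fun y => sq_nonneg _)]
  simpa only [sq, diffQuot_mul, gagSq] using hfin

lemma memLp_sqrt_mul (hV : Continuous V) (hV0 : ∀ x, 0 < V x) {u : EN N → ℝ} (hu : Measurable u)
    (hfin : ∫⁻ x, ENNReal.ofReal (V x * u x ^ 2) < ⊤) :
    MemLp (fun x => √(V x) * u x) 2 := by
  have hm : Measurable (fun x => √(V x) * u x) := hV.measurable.sqrt.mul hu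
  refine (memLp_two_iff_integrable_sq hm.aestronglyMeasurable).2
    ⟨(hm.pow_const 2).aestronglyMeasurable, ?_⟩
  rw [hasFiniteIntegral_iff_ofReal (Eventually.of_forall fun y => sq_nonneg _)]
  simpa only [mul_pow, Real.sq_sqrt (hV0 _).le] using hfin

/-- The Hilbert space `L²(ℝ^N × ℝ^N) ⊕ L²(ℝ^N)` into which `X` embeds isometrically. -/
abbrev PairL2 (N : ℕ) : Type :=
  WithLp 2 (Lp ℝ 2 (volume : Measure (EN N × EN N)) × Lp ℝ 2 (volume : Measure (EN N)))

/-- The isometric embedding of `X`. -/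
def embX (hV : Continuous V) (hV0 : ∀ x, 0 < V x) (u : EN N → ℝ) (hu : memX α V u) : PairL2 N :=
  WithLp.toLp 2 ((memLp_diffQuot hu.1 (lt_of_le_of_lt le_self_add hu.2)).toLp _,
    (memLp_sqrt_mul hV hV0 hu.1 (lt_of_le_of_lt le_add_self hu.2)).toLp _)

lemma inner_embX (hV : Continuous V) (hV0 : ∀ x, 0 < V x) {u v : EN N → ℝ} (hu : memX α V u)
    (hv : memX α V v) :
    inner ℝ (embX hV hV0 u hu) (embX hV hV0 v hv) =
      (∫ p : EN N × EN N, (u p.1 - u p.2) * (v p.1 - v p.2) / ‖p.1 - p.2‖ ^ ((N : ℝ) + 2 * α))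
        + ∫ x, V x * u x * v x := by
  rw [WithLp.prod_inner_apply, L2.inner_def, L2.inner_def]
  congr 1
  · refine integral_congr_ae ?_
    filter_upwards [(memLp_diffQuot hu.1 (lt_of_le_of_lt le_self_add hu.2)).coeFn_toLp,
      (memLp_diffQuot hv.1 (lt_of_le_of_lt le_self_add hv.2)).coeFn_toLp] with p h1 h2
    simp only [embX]
    rw [h1, h2, RCLike.inner_apply, conj_trivial, mul_comm, diffQuot_mul]
  · refine integral_congr_ae ?_
    filter_upwards [(memLp_sqrt_mul hV hV0 hu.1 (lt_of_le_of_lt le_add_self hu.2)).coeFn_toLp,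
      (memLp_sqrt_mul hV hV0 hv.1 (lt_of_le_of_lt le_add_self hv.2)).coeFn_toLp] with x h1 h2
    simp only [embX]
    rw [h1, h2, RCLike.inner_apply, conj_trivial]
    linear_combination (u x * v x) * Real.mul_self_sqrt (hV0 x).le

lemma norm_sq_embX_le (hV : Continuous V) (hV0 : ∀ x, 0 < V x) {u : EN N → ℝ} (hu : memX α V u) :
    ‖embX hV hV0 u hu‖ ^ 2 ≤ (normSq α V u).toReal := by
  rw [← real_inner_self_eq_norm_sq, inner_embX, normSq, ENNReal.toReal_add
    (lt_of_le_of_lt le_self_add hu.2).ne (lt_of_le_of_lt le_add_self hu.2).ne, gagSq]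
  have h1 : ∀ p : EN N × EN N, 0 ≤ (u p.1 - u p.2) ^ 2 / ‖p.1 - p.2‖ ^ ((N : ℝ) + 2 * α) :=
    fun p => by positivity
  have h2 : ∀ x, 0 ≤ V x * u x ^ 2 := fun x => by have := hV0 x; positivity
  have hu' := hu.1
  have hV' := hV.measurable
  rw [← integral_eq_lintegral_of_nonneg_ae (Eventually.of_forall h1)
      (by fun_prop : Measurable _).aestronglyMeasurable,
    ← integral_eq_lintegral_of_nonneg_ae (Eventually.of_forall h2)
      (by fun_prop : Measurable _).aestronglyMeasurable]
  simp only [sq, mul_assoc, le_refl]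

lemma memX_sub {u v : EN N → ℝ} (hV0 : ∀ x, 0 < V x) (hV : Continuous V) (hu : memX α V u)
    (hv : memX α V v) :
    Measurable (fun x => u x - v x) ∧
      normSq α V (fun x => u x - v x) ≤ 2 * normSq α V u + 2 * normSq α V v := by
  have hu' := hu.1
  have hv' := hv.1
  have hV' := hV.measurable
  refine ⟨hu'.sub hv', ?_⟩
  have hsq : ∀ a b : ℝ, (a - b) ^ 2 ≤ 2 * a ^ 2 + 2 * b ^ 2 := fun a b => by
    nlinarith [sq_nonneg (a + b)]
  have h2 : ∀ t : ℝ, 2 * ENNReal.ofReal t = ENNReal.ofReal (2 * t) := fun t => by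
    rw [ENNReal.ofReal_mul (by norm_num), ENNReal.ofReal_ofNat]
  have hA : gagSq N α (fun x => u x - v x) ≤ 2 * gagSq N α u + 2 * gagSq N α v := by
    unfold gagSq
    rw [← lintegral_const_mul' _ _ (by simp), ← lintegral_const_mul' _ _ (by simp),
      ← lintegral_add_left (by fun_prop)]
    refine lintegral_mono fun p => ?_
    rw [h2, h2, ← ENNReal.ofReal_add (by positivity) (by positivity)]
    apply ENNReal.ofReal_le_ofReal
    rw [mul_div_assoc', mul_div_assoc', ← add_div]
    gcongr
    refine le_trans (le_of_eq ?_) (hsq (u p.1 - u p.2) (v p.1 - v p.2))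
    ring
  have hB : ∫⁻ x, ENNReal.ofReal (V x * (u x - v x) ^ 2) ≤
      2 * (∫⁻ x, ENNReal.ofReal (V x * u x ^ 2)) + 2 * ∫⁻ x, ENNReal.ofReal (V x * v x ^ 2) := by
    rw [← lintegral_const_mul' _ _ (by simp), ← lintegral_const_mul' _ _ (by simp),
      ← lintegral_add_left (by fun_prop)]
    refine lintegral_mono fun x => ?_
    have := hV0 x
    rw [h2, h2, ← ENNReal.ofReal_add (by positivity) (by positivity)]
    apply ENNReal.ofReal_le_ofReal
    nlinarith [hsq (u x) (v x)]
  refine (add_le_add hA hB).trans_eq ?_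
  unfold normSq
  ring

lemma tendsto_ballAvg_of_weak (hV : Continuous V) (hV0 : ∀ x, 0 < V x) {z : ℕ → EN N → ℝ}
    (hz : ∀ n, memX α V (z n)) {M : ℝ} (hM : ∀ n, normSq α V (z n) ≤ ENNReal.ofReal M)
    (hM0 : 0 ≤ M)
    (hweak : ∀ v, memX α V v → Tendsto (fun n =>
      (∫ p : EN N × EN N, (z n p.1 - z n p.2) * (v p.1 - v p.2)
          / ‖p.1 - p.2‖ ^ ((N : ℝ) + 2 * α)) + ∫ x, V x * z n x * v x) atTop (𝓝 0))
    (r : ℝ) (x : EN N) :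
    Tendsto (fun n => ballAvg (z n) r x) atTop (𝓝 0) := by
  obtain ⟨m, hm, hmV⟩ := exists_pos_le_of_isCompact hV hV0 (isCompact_closedBall x r)
  have hgm : Measurable ((ball x r).indicator fun y => (√(V y))⁻¹) :=
    hV.measurable.sqrt.inv.indicator measurableSet_ball
  have hg : MemLp ((ball x r).indicator fun y => (√(V y))⁻¹) 2 := by
    rw [memLp_indicator_iff_restrict measurableSet_ball]
    have : IsFiniteMeasure (volume.restrict (ball x r)) :=
      ⟨by simpa using measure_ball_lt_top⟩
    refine MemLp.of_bound hV.measurable.sqrt.inv.aestronglyMeasurable (√m)⁻¹ ?_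
    filter_upwards [ae_restrict_mem measurableSet_ball] with y hy
    rw [Real.norm_of_nonneg (by positivity)]
    exact inv_anti₀ (Real.sqrt_pos.2 hm) (Real.sqrt_le_sqrt (hmV y (ball_subset_closedBall hy)))
  have key := tendsto_inner_zero_of_forall_mem
    (T := {h | ∃ v, ∃ hv : memX α V v, h = embX hV hV0 v hv})
    (z := fun n => embX hV hV0 (z n) (hz n)) (fun n => ⟨z n, hz n, rfl⟩) (B := √M)
    (fun n => by
      refine Real.le_sqrt_of_sq_le ((norm_sq_embX_le hV hV0 (hz n)).trans ?_)
      exact ENNReal.toReal_le_of_le_ofReal hM0 (hM n))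
    (by
      rintro _ ⟨v, hv, rfl⟩
      simpa only [inner_embX] using hweak v hv)
    (WithLp.toLp 2 (0, hg.toLp _))
  have heq : ∀ n, inner ℝ (embX hV hV0 (z n) (hz n)) (WithLp.toLp 2 (0, hg.toLp _)) =
      ∫ y in ball x r, z n y := by
    intro n
    rw [WithLp.prod_inner_apply]
    dsimp only [embX]
    rw [inner_zero_right, zero_add, L2.inner_def, ← integral_indicator measurableSet_ball]
    refine integral_congr_ae ?_
    filter_upwards [(memLp_sqrt_mul hV hV0 (hz n).1
      (lt_of_le_of_lt le_add_self (hz n).2)).coeFn_toLp, hg.coeFn_toLp] with y h1 h2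
    rw [h1, h2, RCLike.inner_apply, conj_trivial]
    by_cases hy : y ∈ ball x r
    · rw [Set.indicator_of_mem hy, Set.indicator_of_mem hy]
      have := Real.sqrt_pos.2 (hV0 y)
      field_simp
    · simp [hy]
  simp only [heq] at key
  have := key.const_mul (volume.real (ball x r))⁻¹
  simpa only [ballAvg, setAverage_eq, smul_eq_mul, mul_zero] using this

end Embedding

section Compactness

variable {N : ℕ} {α : ℝ} {V u : EN N → ℝ}

lemma measurable_ballAvg (hu : Measurable u) {r : ℝ} (hr : 0 < r) : Measurable (ballAvg u r) := by
  have hset : MeasurableSet {p : EN N × EN N | dist p.2 p.1 < r} :=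
    measurableSet_lt (by fun_prop) measurable_const
  have hind : StronglyMeasurable ({p : EN N × EN N | dist p.2 p.1 < r}.indicator fun p => u p.2) :=
    ((hu.comp measurable_snd).indicator hset).stronglyMeasurable
  have h := (hind.integral_prod_right' (ν := volume)).measurable.const_mul (unitVol N * r ^ N)⁻¹
  convert h using 1
  ext x
  have hω := unitVol_pos N
  rw [ballAvg, setAverage_eq, Measure.real, volume_ball_eq x hr,
    ENNReal.toReal_ofReal (by positivity), smul_eq_mul, ← integral_indicator measurableSet_ball]
  rfl

lemma lintegral_sq_sub_ballAvg_le (hα : 0 < α) (hu : Measurable u) (hloc : LocallyIntegrable u)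
    {r : ℝ} (hr : 0 < r) :
    ∫⁻ x, ENNReal.ofReal ((u x - ballAvg u r x) ^ 2) ≤
      ENNReal.ofReal ((unitVol N)⁻¹ * r ^ (2 * α)) * gagSq N α u := by
  rw [← lintegral_gagDens hu, ← lintegral_const_mul' _ _ ENNReal.ofReal_ne_top]
  exact lintegral_mono fun x => ofReal_sq_sub_ballAvg_le (by positivity) hloc hr x

/-- A finite measure equivalent to and dominated by Lebesgue measure. -/
def tameMeasure (N : ℕ) : Measure (EN N) :=
  volume.withDensity fun x => ENNReal.ofReal ((1 + ‖x‖) ^ (-((N : ℝ) + 1)))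

lemma tameMeasure_le (N : ℕ) : tameMeasure N ≤ volume := by
  refine (withDensity_mono (Eventually.of_forall fun x => ?_)).trans_eq withDensity_one
  rw [Pi.one_apply, ← ENNReal.ofReal_one]
  refine ENNReal.ofReal_le_ofReal (Real.rpow_le_one_of_one_le_of_nonpos ?_ ?_)
  · linarith [norm_nonneg x]
  · linarith [N.cast_nonneg (α := ℝ)]

instance (N : ℕ) : IsFiniteMeasure (tameMeasure N) := by
  refine isFiniteMeasure_withDensity_ofReal (Integrable.hasFiniteIntegral ?_)
  exact integrable_one_add_norm (by simp)

lemma ae_volume_of_ae_tameMeasure {p : EN N → Prop} (h : ∀ᵐ x ∂tameMeasure N, p x) :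
    ∀ᵐ x, p x := by
  rw [tameMeasure, ae_withDensity_iff (by fun_prop)] at h
  filter_upwards [h] with x hx
  refine hx (ENNReal.ofReal_pos.2 ?_).ne'
  have := norm_nonneg x
  positivity

lemma tendsto_lintegral_sq_tameMeasure (hα : 0 < α) (hN : 2 * α < N) (hV : Continuous V)
    (hV0 : ∀ x, 0 < V x) {z : ℕ → EN N → ℝ} (hz : ∀ n, memX α V (z n)) {M : ℝ} (hM0 : 0 ≤ M)
    (hM : ∀ n, normSq α V (z n) ≤ ENNReal.ofReal M)
    (havg : ∀ r x, Tendsto (fun n => ballAvg (z n) r x) atTop (𝓝 0)) :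
    Tendsto (fun n => ∫⁻ x, ENNReal.ofReal (z n x ^ 2) ∂tameMeasure N) atTop (𝓝 0) := by
  obtain ⟨C, hC0, hC⟩ := exists_sobolev_decomposition hα hN hV hV0 hM0
  rw [ENNReal.tendsto_nhds_zero]
  intro ε hε
  obtain ⟨r, hr, hr0⟩ : ∃ r : ℝ,
      2 * ENNReal.ofReal ((unitVol N)⁻¹ * r ^ (2 * α) * M) ≤ ε / 2 ∧ 0 < r := by
    have h1 : Continuous fun r : ℝ => (unitVol N)⁻¹ * r ^ (2 * α) * M :=
      (continuous_const.mul (continuous_id.rpow_const fun _ => Or.inr (by positivity))).mul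
        continuous_const
    have h2 : Tendsto (fun r : ℝ => 2 * ENNReal.ofReal ((unitVol N)⁻¹ * r ^ (2 * α) * M))
        (𝓝[>] 0) (𝓝 0) := by
      have h3 := (ENNReal.Tendsto.const_mul (a := 2)
        ((ENNReal.continuous_ofReal.comp h1).tendsto 0) (Or.inr (by simp)))
      have h4 : (0 : ℝ) ^ (2 * α) = 0 := Real.zero_rpow (by positivity)
      simp only [Function.comp_apply, h4, mul_zero, zero_mul, ENNReal.ofReal_zero] at h3
      exact h3.mono_left nhdsWithin_le_nhds
    have h5 := (ENNReal.tendsto_nhds_zero.1 h2 (ε / 2) (ENNReal.half_pos hε.ne')).and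
      self_mem_nhdsWithin
    exact h5.exists
  have hbound : ∀ n x, ballAvg (z n) r x ^ 2 ≤ 2 * (C * r ^ (2 * α - N)) + 2 * C := by
    intro n x
    obtain ⟨c, hc1, -, hc2⟩ := hC (z n) (hz n).1 (hM n)
    nlinarith [hc2 x r hr0, sq_nonneg (ballAvg (z n) r x - c - c)]
  have hdom : Tendsto (fun n => ∫⁻ x, ENNReal.ofReal (ballAvg (z n) r x ^ 2) ∂tameMeasure N) atTop
      (𝓝 0) := by
    have := tendsto_lintegral_of_dominated_convergence (μ := tameMeasure N)
      (F := fun n x => ENNReal.ofReal (ballAvg (z n) r x ^ 2)) (f := fun _ => 0)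
      (fun _ => ENNReal.ofReal (2 * (C * r ^ (2 * α - N)) + 2 * C))
      (fun n => ((measurable_ballAvg (hz n).1 hr0).pow_const 2).ennreal_ofReal)
      (fun n => Eventually.of_forall fun x => ENNReal.ofReal_le_ofReal (hbound n x))
      (by
        rw [lintegral_const]
        exact ENNReal.mul_ne_top ENNReal.ofReal_ne_top (measure_ne_top _ _))
      (Eventually.of_forall fun x => by
        have := ENNReal.tendsto_ofReal ((havg r x).pow 2)
        simpa using this)
    simpa using this
  have hdom2 := ENNReal.Tendsto.const_mul (a := 2) hdom (Or.inr (by simp))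
  rw [mul_zero] at hdom2
  filter_upwards [ENNReal.tendsto_nhds_zero.1 hdom2 (ε / 2) (ENNReal.half_pos hε.ne')] with n hn
  have h2 : ∀ t : ℝ, 2 * ENNReal.ofReal t = ENNReal.ofReal (2 * t) := fun t => by
    rw [ENNReal.ofReal_mul (by norm_num), ENNReal.ofReal_ofNat]
  have hmA := measurable_ballAvg (hz n).1 hr0
  have hmz := (hz n).1
  calc ∫⁻ x, ENNReal.ofReal (z n x ^ 2) ∂tameMeasure N
      ≤ ∫⁻ x, (2 * ENNReal.ofReal ((z n x - ballAvg (z n) r x) ^ 2) +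
          2 * ENNReal.ofReal (ballAvg (z n) r x ^ 2)) ∂tameMeasure N := by
        refine lintegral_mono fun x => ?_
        rw [h2, h2, ← ENNReal.ofReal_add (by positivity) (by positivity)]
        apply ENNReal.ofReal_le_ofReal
        nlinarith [sq_nonneg (z n x - ballAvg (z n) r x - ballAvg (z n) r x)]
    _ = 2 * (∫⁻ x, ENNReal.ofReal ((z n x - ballAvg (z n) r x) ^ 2) ∂tameMeasure N) +
          2 * ∫⁻ x, ENNReal.ofReal (ballAvg (z n) r x ^ 2) ∂tameMeasure N := by
        rw [lintegral_add_left (by fun_prop), lintegral_const_mul' _ _ (by simp),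
          lintegral_const_mul' _ _ (by simp)]
    _ ≤ ε / 2 + ε / 2 := by
        refine add_le_add (le_trans ?_ hr) hn
        gcongr
        refine (lintegral_mono' (tameMeasure_le N) le_rfl).trans ?_
        refine (lintegral_sq_sub_ballAvg_le hα hmz
          (locallyIntegrable_of_memX hV hV0 (hz n)) hr0).trans ?_
        have hω := unitVol_pos N
        rw [ENNReal.ofReal_mul (q := M) (by positivity)]
        gcongr
        exact le_self_add.trans (hM n)
    _ = ε := ENNReal.add_halves ε

lemma exists_subseq_tendsto_ae (hα : 0 < α) (hN : 2 * α < N) (hV : Continuous V)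
    (hV0 : ∀ x, 0 < V x) {z : ℕ → EN N → ℝ} (hz : ∀ n, memX α V (z n)) {M : ℝ} (hM0 : 0 ≤ M)
    (hM : ∀ n, normSq α V (z n) ≤ ENNReal.ofReal M)
    (havg : ∀ r x, Tendsto (fun n => ballAvg (z n) r x) atTop (𝓝 0)) :
    ∃ φ : ℕ → ℕ, StrictMono φ ∧ ∀ᵐ x, Tendsto (fun n => z (φ n) x) atTop (𝓝 0) := by
  have h := tendsto_lintegral_sq_tameMeasure hα hN hV hV0 hz hM0 hM havg
  have hmeas : TendstoInMeasure (tameMeasure N) (fun n x => z n x ^ 2) atTop (fun _ => 0) := by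
    refine tendstoInMeasure_of_tendsto_eLpNorm one_ne_zero
      (fun n => ((hz n).1.pow_const 2).aestronglyMeasurable) aestronglyMeasurable_const ?_
    convert h using 2 with n
    rw [eLpNorm_one_eq_lintegral_enorm]
    refine lintegral_congr fun x => ?_
    rw [Pi.sub_apply, sub_zero, Real.enorm_of_nonneg (sq_nonneg _)]
  obtain ⟨φ, hφ, hae⟩ := hmeas.exists_seq_tendsto_ae
  refine ⟨φ, hφ, ?_⟩
  filter_upwards [ae_volume_of_ae_tameMeasure hae] with x hx
  have := hx.sqrt
  simp only [Real.sqrt_sq_eq_abs, Real.sqrt_zero] at this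
  exact (tendsto_zero_iff_abs_tendsto_zero _).2 this

end Compactness

/-- Growth condition: `G` is `o(t²)` at `0` and `o(|t|^q)` at infinity, in integrated form. -/
def SubcriticalGrowth (G : ℝ → ℝ) (q : ℝ) : Prop :=
  ∀ η : ℝ, 0 < η → ∃ δ : ℝ, 0 < δ ∧ ∃ C : ℝ, 0 ≤ C ∧ ∀ t : ℝ,
    |G t| ≤ η * (t ^ 2 + |t| ^ q) + {s : ℝ | δ ≤ |s|}.indicator (fun _ => C) t

lemma subcriticalGrowth_of_bounds {G : ℝ → ℝ} {q : ℝ} (hG : Continuous G)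
    (h0 : ∀ η : ℝ, 0 < η → ∃ δ : ℝ, 0 < δ ∧ ∀ t : ℝ, |t| < δ → |G t| ≤ η * t ^ 2)
    (hinf : ∀ η : ℝ, 0 < η → ∃ R : ℝ, ∀ t : ℝ, R ≤ |t| → |G t| ≤ η * |t| ^ q) :
    SubcriticalGrowth G q := by
  intro η hη
  obtain ⟨δ, hδ, h0'⟩ := h0 η hη
  obtain ⟨R, hR⟩ := hinf η hη
  obtain ⟨C, hC⟩ := (isCompact_Icc (a := -R) (b := R)).exists_bound_of_continuousOn
    hG.continuousOn
  refine ⟨δ, hδ, max C 0, le_max_right _ _, fun t => ?_⟩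
  have hA : 0 ≤ η * t ^ 2 := by positivity
  have hB : 0 ≤ η * |t| ^ q := by positivity
  rw [mul_add]
  by_cases ht : |t| < δ
  · have := h0' t ht
    rw [Set.indicator_of_notMem (by simpa using ht)]
    linarith
  · rw [Set.indicator_of_mem (by simpa using ht)]
    have hmax := le_max_right C 0
    by_cases hRt : R ≤ |t|
    · have := hR t hRt
      linarith
    · have := hC t (abs_le.1 (not_le.1 hRt).le)
      rw [Real.norm_eq_abs] at this
      linarith [le_max_left C 0]

section Convergence

variable {X : Type*} [MeasurableSpace X] {μ : Measure X} {G : ℝ → ℝ} {q : ℝ}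

lemma measurable_growth {v : X → ℝ} (hv : Measurable v) :
    Measurable fun x => v x ^ 2 + |v x| ^ q := by
  have := measurable_abs.comp hv
  exact (hv.pow_const 2).add (this.pow_const q)

lemma integrable_comp_of_growth (hG : Continuous G) (hgr : SubcriticalGrowth G q) {v : X → ℝ}
    (hv : Measurable v) (hfin : ∫⁻ x, ENNReal.ofReal (v x ^ 2 + |v x| ^ q) ∂μ < ⊤) :
    Integrable (fun x => G (v x)) μ := by
  obtain ⟨δ, hδ, C, hC, hbd⟩ := hgr 1 one_pos
  have hset : MeasurableSet {x | δ ≤ |v x|} := measurableSet_le measurable_const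
    (measurable_abs.comp hv)
  have hm := measurable_growth (q := q) hv
  have hint : Integrable (fun x => v x ^ 2 + |v x| ^ q) μ := by
    refine ⟨hm.aestronglyMeasurable, ?_⟩
    rwa [hasFiniteIntegral_iff_ofReal (Eventually.of_forall fun x => by positivity)]
  have hfinset : μ {x | δ ≤ |v x|} < ⊤ := by
    refine lt_of_le_of_lt (measure_mono ?_)
      (hint.measure_ge_lt_top (show 0 < δ ^ 2 by positivity))
    intro x hx
    have h1 : δ ^ 2 ≤ v x ^ 2 := by
      rw [← sq_abs (v x)]
      exact pow_le_pow_left₀ hδ.le hx 2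
    have h2 : 0 ≤ |v x| ^ q := by positivity
    exact h1.trans (by linarith)
  have hind : Integrable ({x | δ ≤ |v x|}.indicator fun _ => C) μ :=
    (integrable_indicator_iff hset).2 (integrableOn_const hfinset.ne)
  refine ((hint.const_mul 1).add hind).mono' (hG.measurable.comp hv).aestronglyMeasurable ?_
  exact Eventually.of_forall fun x => hbd (v x)

/-- Convergence of nonlinear integrals under subcritical growth, for a.e. convergent, bounded and
tight sequences. -/
lemma tendsto_integral_comp_of_growth (hG : Continuous G) (hgr : SubcriticalGrowth G q)
    {v : ℕ → X → ℝ} {w : X → ℝ} (hv : ∀ n, Measurable (v n)) (hw : Measurable w)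
    (hae : ∀ᵐ x ∂μ, Tendsto (fun n => v n x) atTop (𝓝 (w x))) {S : ℝ} (hS : 0 ≤ S)
    (hvS : ∀ n, ∫⁻ x, ENNReal.ofReal (v n x ^ 2 + |v n x| ^ q) ∂μ ≤ ENNReal.ofReal S)
    (hwS : ∫⁻ x, ENNReal.ofReal (w x ^ 2 + |w x| ^ q) ∂μ ≤ ENNReal.ofReal S)
    (htight : ∀ δ : ℝ, 0 < δ → ∀ ε : ℝ, 0 < ε → ∃ B : Set X, MeasurableSet B ∧ μ B < ⊤ ∧
      (∀ n, μ ({x | δ ≤ |v n x|} ∩ Bᶜ) ≤ ENNReal.ofReal ε) ∧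
      μ ({x | δ ≤ |w x|} ∩ Bᶜ) ≤ ENNReal.ofReal ε) :
    Tendsto (fun n => ∫ x, G (v n x) ∂μ) atTop (𝓝 (∫ x, G (w x) ∂μ)) := by
  refine tendsto_integral_of_L1 _ (hG.measurable.comp hw).aestronglyMeasurable
    (Eventually.of_forall fun n => integrable_comp_of_growth hG hgr (hv n)
      ((hvS n).trans_lt ENNReal.ofReal_lt_top)) ?_
  rw [ENNReal.tendsto_nhds_zero]
  intro ε' hε'
  obtain ⟨ε, hε, hεε'⟩ : ∃ ε : ℝ, 0 < ε ∧ ENNReal.ofReal ε ≤ ε' := by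
    rcases eq_or_ne ε' ⊤ with rfl | htop
    · exact ⟨1, one_pos, le_top⟩
    · exact ⟨ε'.toReal, ENNReal.toReal_pos hε'.ne' htop, ENNReal.ofReal_toReal_le⟩
  set η := ε / 3 / (2 * S + 1) with hη
  have hη0 : 0 < η := by positivity
  obtain ⟨δ, hδ, C, hC, hbd⟩ := hgr η hη0
  obtain ⟨B, hB, hBfin, hBv, hBw⟩ := htight δ hδ (ε / 3 / (2 * C + 1)) (by positivity)
  set Φ : ℝ → ℝ := fun t => t ^ 2 + |t| ^ q with hΦ
  have hΦ0 : ∀ t, 0 ≤ Φ t := fun t => by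
    rw [hΦ]
    positivity
  set h : ℕ → X → ENNReal := fun n x =>
    ENNReal.ofReal (|G (v n x) - G (w x)| - η * (Φ (v n x) + Φ (w x))) with hh
  have hΦv : ∀ n, Measurable fun x => Φ (v n x) := fun n => measurable_growth (hv n)
  have hΦw : Measurable fun x => Φ (w x) := measurable_growth hw
  have hGv : ∀ n, Measurable fun x => G (v n x) := fun n => hG.measurable.comp (hv n)
  have hGw : Measurable fun x => G (w x) := hG.measurable.comp hw
  have hmeas : ∀ n, Measurable (h n) := fun n =>
    (((measurable_abs.comp ((hGv n).sub hGw)).sub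
      (((hΦv n).add hΦw).const_mul η))).ennreal_ofReal
  have hle : ∀ n x, h n x ≤ ENNReal.ofReal C * ({x | δ ≤ |v n x|}.indicator 1 x +
      {x | δ ≤ |w x|}.indicator 1 x) := by
    intro n x
    have e : ∀ t : ℝ, ({s : ℝ | δ ≤ |s|}.indicator (fun _ => C) t : ℝ) =
        C * {s : ℝ | δ ≤ |s|}.indicator 1 t := fun t => by
      by_cases ht : δ ≤ |t| <;> simp [Set.indicator, ht]
    have e2 : ∀ g : X → ℝ, ({x | δ ≤ |g x|}.indicator 1 x : ENNReal) =
        ENNReal.ofReal ({s : ℝ | δ ≤ |s|}.indicator 1 (g x)) := fun g => by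
      by_cases ht : δ ≤ |g x| <;> simp [Set.indicator, ht]
    have hnn : ∀ t : ℝ, (0 : ℝ) ≤ {s : ℝ | δ ≤ |s|}.indicator 1 t := fun t =>
      Set.indicator_nonneg (by simp) t
    rw [e2, e2, ← ENNReal.ofReal_add (hnn _) (hnn _), ← ENNReal.ofReal_mul hC]
    apply ENNReal.ofReal_le_ofReal
    have h1 := hbd (v n x)
    have h2 := hbd (w x)
    rw [e] at h1 h2
    have h3 := abs_sub (G (v n x)) (G (w x))
    simp only [hΦ]
    linarith
  have hset : ∀ g : X → ℝ, Measurable g → MeasurableSet {x | δ ≤ |g x|} := fun g hg =>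
    measurableSet_le measurable_const (measurable_abs.comp hg)
  have houter : ∀ n, ∫⁻ x in Bᶜ, h n x ∂μ ≤ ENNReal.ofReal (ε / 3) := by
    intro n
    calc ∫⁻ x in Bᶜ, h n x ∂μ
        ≤ ∫⁻ x in Bᶜ, ENNReal.ofReal C * ({x | δ ≤ |v n x|}.indicator 1 x +
            {x | δ ≤ |w x|}.indicator 1 x) ∂μ := lintegral_mono (hle n)
      _ = ENNReal.ofReal C * (μ ({x | δ ≤ |v n x|} ∩ Bᶜ) + μ ({x | δ ≤ |w x|} ∩ Bᶜ)) := by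
          rw [lintegral_const_mul' _ _ ENNReal.ofReal_ne_top,
            lintegral_add_left (measurable_one.indicator (hset _ (hv n))),
            lintegral_indicator_one (hset _ (hv n)), lintegral_indicator_one (hset _ hw),
            Measure.restrict_apply (hset _ (hv n)), Measure.restrict_apply (hset _ hw)]
      _ ≤ ENNReal.ofReal C * (ENNReal.ofReal (ε / 3 / (2 * C + 1)) +
            ENNReal.ofReal (ε / 3 / (2 * C + 1))) := by
          gcongr
          exact hBv n
      _ ≤ ENNReal.ofReal (ε / 3) := by
          rw [← ENNReal.ofReal_add (by positivity) (by positivity), ← ENNReal.ofReal_mul hC]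
          apply ENNReal.ofReal_le_ofReal
          rw [← add_div, mul_div_assoc', div_le_iff₀ (by positivity)]
          nlinarith
  have hinner : Tendsto (fun n => ∫⁻ x in B, h n x ∂μ) atTop (𝓝 0) := by
    have := tendsto_lintegral_of_dominated_convergence (μ := μ.restrict B) (F := h)
      (f := fun _ => 0) (fun _ => ENNReal.ofReal C * (1 + 1)) hmeas
      (fun n => Eventually.of_forall fun x => (hle n x).trans
        (mul_le_mul_right (add_le_add (Set.indicator_le_self _ _ _)
          (Set.indicator_le_self _ _ _)) _))
      (by
        rw [lintegral_const, Measure.restrict_apply_univ]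
        exact ENNReal.mul_ne_top (ENNReal.mul_ne_top ENNReal.ofReal_ne_top (by simp)) hBfin.ne)
      (by
        filter_upwards [ae_restrict_of_ae hae] with x hx
        have h1 : Tendsto (fun n => ENNReal.ofReal |G (v n x) - G (w x)|) atTop (𝓝 0) := by
          have h2 := (((hG.tendsto (w x)).comp hx).sub_const (G (w x))).abs
          rw [sub_self, abs_zero] at h2
          simpa using ENNReal.tendsto_ofReal h2
        refine tendsto_of_tendsto_of_tendsto_of_le_of_le tendsto_const_nhds h1
          (fun _ => zero_le) fun n => ?_
        apply ENNReal.ofReal_le_ofReal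
        have := mul_nonneg hη0.le (add_nonneg (hΦ0 (v n x)) (hΦ0 (w x)))
        linarith)
    simpa using this
  filter_upwards [ENNReal.tendsto_nhds_zero.1 hinner (ENNReal.ofReal (ε / 3))
    (ENNReal.ofReal_pos.2 (by positivity))] with n hn
  refine le_trans ?_ hεε'
  calc ∫⁻ x, ‖G (v n x) - G (w x)‖ₑ ∂μ
      ≤ ∫⁻ x, (ENNReal.ofReal η * (ENNReal.ofReal (Φ (v n x)) + ENNReal.ofReal (Φ (w x))) +
          h n x) ∂μ := by
        refine lintegral_mono fun x => ?_
        rw [← ENNReal.ofReal_add (hΦ0 _) (hΦ0 _), ← ENNReal.ofReal_mul hη0.le,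
          Real.enorm_eq_ofReal_abs]
        refine le_trans (ENNReal.ofReal_le_ofReal (le_of_eq ?_)) ENNReal.ofReal_add_le
        ring
    _ = ENNReal.ofReal η * (∫⁻ x, ENNReal.ofReal (Φ (v n x)) ∂μ +
          ∫⁻ x, ENNReal.ofReal (Φ (w x)) ∂μ) + (∫⁻ x in B, h n x ∂μ + ∫⁻ x in Bᶜ, h n x ∂μ) := by
        rw [lintegral_add_right _ (hmeas n), lintegral_const_mul' _ _ ENNReal.ofReal_ne_top,
          lintegral_add_right _ hΦw.ennreal_ofReal, lintegral_add_compl _ hB]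
    _ ≤ ENNReal.ofReal η * (ENNReal.ofReal S + ENNReal.ofReal S) +
          (ENNReal.ofReal (ε / 3) + ENNReal.ofReal (ε / 3)) := by
        gcongr
        · exact hvS n
        · exact houter n
    _ ≤ ENNReal.ofReal ε := by
        rw [← ENNReal.ofReal_add hS hS, ← ENNReal.ofReal_mul hη0.le,
          ← ENNReal.ofReal_add (by positivity) (by positivity),
          ← ENNReal.ofReal_add (by positivity) (by positivity)]
        apply ENNReal.ofReal_le_ofReal
        have : η * (S + S) ≤ ε / 3 := by
          rw [hη, div_mul_eq_mul_div, div_le_iff₀ (by positivity)]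
          nlinarith
        linarith

end Convergence

section Nonlinearity

variable {f : ℝ → ℝ} {q : ℝ}

lemma Cf1.exists_abs_le (hf : Continuous f) (hf1 : Cf1 f) {η : ℝ} (hη : 0 < η) :
    ∃ δ : ℝ, 0 < δ ∧ ∀ t : ℝ, |t| < δ → |f t| ≤ η * |t| := by
  have h := (Metric.tendsto_nhdsWithin_nhds.1 hf1) η hη
  obtain ⟨δ, hδ, h⟩ := h
  have hne : ∀ t : ℝ, t ≠ 0 → |t| < δ → |f t| ≤ η * |t| := by
    intro t ht htδ
    have h1 := h (x := t) ht (by rwa [dist_zero_right])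
    rw [dist_zero_right, Real.norm_eq_abs, abs_div, abs_abs, div_lt_iff₀ (abs_pos.2 ht)] at h1
    exact h1.le
  refine ⟨δ, hδ, fun t htδ => ?_⟩
  rcases eq_or_ne t 0 with rfl | ht
  · have h1 : Tendsto (fun t => |f t|) (𝓝[≠] 0) (𝓝 |f 0|) :=
      (hf.abs.tendsto 0).mono_left nhdsWithin_le_nhds
    have h2 : Tendsto (fun t : ℝ => η * |t|) (𝓝[≠] 0) (𝓝 (η * |0|)) :=
      ((continuous_const.mul continuous_abs).tendsto 0).mono_left nhdsWithin_le_nhds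
    refine le_of_tendsto_of_tendsto h1 h2 ?_
    have h3 : ∀ᶠ t : ℝ in 𝓝[≠] 0, |t| < δ :=
      nhdsWithin_le_nhds ((continuous_abs.tendsto (0 : ℝ)).eventually (gt_mem_nhds (by simpa)))
    filter_upwards [h3, self_mem_nhdsWithin] with s hs hs0
    exact hne s hs0 hs
  · exact hne t ht htδ

lemma Cf2.exists_abs_le (hf2 : Cf2 f q) {η : ℝ} (hη : 0 < η) :
    ∃ R : ℝ, 0 < R ∧ ∀ t : ℝ, R ≤ |t| → |f t| ≤ η * |t| ^ (q - 1) := by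
  have h := (Metric.tendsto_nhds.1 hf2) η hη
  rw [eventually_comap, eventually_atTop] at h
  obtain ⟨R, h⟩ := h
  refine ⟨max R 1, by positivity, fun t ht => ?_⟩
  have h1 := h |t| ((le_max_left _ _).trans ht) t rfl
  have ht0 : 0 < |t| := one_pos.trans_le ((le_max_right _ _).trans ht)
  have h2 : 0 < |t| ^ (q - 1) := Real.rpow_pos_of_pos ht0 _
  rw [dist_zero_right, Real.norm_eq_abs, abs_div, abs_of_pos h2, div_lt_iff₀ h2] at h1
  exact h1.le

lemma rpow_sub_one_mul_abs {t : ℝ} (ht : 0 < |t|) (q : ℝ) : |t| ^ (q - 1) * |t| = |t| ^ q := by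
  nth_rewrite 2 [← Real.rpow_one |t|]
  rw [← Real.rpow_add ht, sub_add_cancel]

lemma subcriticalGrowth_mul_self (hf : Continuous f) (hf1 : Cf1 f) (hf2 : Cf2 f q) :
    SubcriticalGrowth (fun t => f t * t) q := by
  refine subcriticalGrowth_of_bounds (hf.mul continuous_id) (fun η hη => ?_) fun η hη => ?_
  · obtain ⟨δ, hδ, h⟩ := hf1.exists_abs_le hf hη
    refine ⟨δ, hδ, fun t ht => ?_⟩
    rw [abs_mul, ← sq_abs t, sq, ← mul_assoc]
    gcongr
    exact h t ht
  · obtain ⟨R, hR0, h⟩ := hf2.exists_abs_le hη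
    refine ⟨R, fun t ht => ?_⟩
    rw [abs_mul, ← rpow_sub_one_mul_abs (hR0.trans_le ht), ← mul_assoc]
    gcongr
    exact h t ht

lemma continuous_prim (hf : Continuous f) : Continuous (prim f) :=
  intervalIntegral.continuous_primitive (fun a b => hf.intervalIntegrable a b) 0

lemma abs_prim_le {t B : ℝ} (h : ∀ s : ℝ, |s| ≤ |t| → |f s| ≤ B) : |prim f t| ≤ B * |t| := by
  have := intervalIntegral.norm_integral_le_of_norm_le_const (a := 0) (b := t) (f := f) (C := B)
    fun s hs => h s (by
      have := Set.abs_sub_left_of_mem_uIcc (Set.uIoc_subset_uIcc hs)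
      simpa using this)
  simpa [prim] using this

lemma subcriticalGrowth_prim (hq : 1 < q) (hf : Continuous f) (hf1 : Cf1 f) (hf2 : Cf2 f q) :
    SubcriticalGrowth (prim f) q := by
  refine subcriticalGrowth_of_bounds (continuous_prim hf) (fun η hη => ?_) fun η hη => ?_
  · obtain ⟨δ, hδ, h⟩ := hf1.exists_abs_le hf hη
    refine ⟨δ, hδ, fun t ht => ?_⟩
    rw [← sq_abs t, sq, ← mul_assoc]
    refine abs_prim_le fun s hs => (h s (hs.trans_lt ht)).trans ?_
    gcongr
  · obtain ⟨R, hR0, h⟩ := hf2.exists_abs_le (half_pos hη)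
    obtain ⟨C, hC⟩ := (isCompact_Icc (a := -R) (b := R)).exists_bound_of_continuousOn
      hf.continuousOn
    obtain ⟨R', hR'⟩ := eventually_atTop.1
      ((tendsto_rpow_atTop (sub_pos.2 hq)).eventually_ge_atTop (C / (η / 2)))
    refine ⟨max R R', fun t ht => ?_⟩
    have htR : R ≤ |t| := (le_max_left _ _).trans ht
    have hCt := hR' |t| ((le_max_right _ _).trans ht)
    rw [div_le_iff₀ (by positivity)] at hCt
    rw [← rpow_sub_one_mul_abs (hR0.trans_le htR), ← mul_assoc]
    refine abs_prim_le fun s hs => ?_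
    by_cases hsR : R ≤ |s|
    · refine (h s hsR).trans ?_
      gcongr
      linarith
    · have h1 := hC s (abs_le.1 (not_le.1 hsR).le)
      rw [Real.norm_eq_abs] at h1
      have : 0 ≤ |t| ^ (q - 1) := by positivity
      nlinarith

end Nonlinearity

section Weighted

variable {N : ℕ} {α : ℝ} {V K u : EN N → ℝ}

/-- The measure `K(x) dx`. -/
def weightMeasure (K : EN N → ℝ) : Measure (EN N) :=
  volume.withDensity fun x => ENNReal.ofReal (K x)

lemma abs_rpow_eq_sq_rpow (t q : ℝ) : |t| ^ q = (t ^ 2) ^ (q / 2) := by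
  rw [← sq_abs, ← Real.rpow_natCast, ← Real.rpow_mul (abs_nonneg _)]
  congr 1
  push_cast
  ring

/-- If `X` contains a function with nonzero mean value at infinity, then `K` is integrable. -/
lemma lintegral_weight_lt_top {K₀ C₃ : ℝ} (hK₀ : 0 ≤ K₀) (hC₃ : 0 ≤ C₃) (hV0 : ∀ x, 0 < V x)
    (hK : ∀ x, K x ≤ K₀) (hKV : ∀ x, K x ≤ C₃ * V x) (hu : Measurable u)
    (hfin : normSq α V u < ⊤) {q c : ℝ} (hq : 0 ≤ q) (hc : c ≠ 0)
    (hL : ∫⁻ x, ENNReal.ofReal (|u x - c| ^ q) < ⊤) : ∫⁻ x, ENNReal.ofReal (K x) < ⊤ := by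
  have hc0 : 0 < |c| / 2 := by positivity
  set a := K₀ * ((|c| / 2) ^ q)⁻¹ with ha
  set b := C₃ * ((|c| / 2) ^ 2)⁻¹ with hb
  have ha0 : 0 ≤ a := by positivity
  have hb0 : 0 ≤ b := by positivity
  calc ∫⁻ x, ENNReal.ofReal (K x)
      ≤ ∫⁻ x, (ENNReal.ofReal a * ENNReal.ofReal (|u x - c| ^ q) +
          ENNReal.ofReal b * ENNReal.ofReal (V x * u x ^ 2)) := by
        refine lintegral_mono fun x => ?_
        have hVx := hV0 x
        rw [← ENNReal.ofReal_mul ha0, ← ENNReal.ofReal_mul hb0,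
          ← ENNReal.ofReal_add (by positivity) (by positivity)]
        apply ENNReal.ofReal_le_ofReal
        have h1 : 0 ≤ a * |u x - c| ^ q := by positivity
        have h2 : 0 ≤ b * (V x * u x ^ 2) := by positivity
        by_cases hx : |c| / 2 ≤ |u x - c|
        · have h3 : 1 ≤ ((|c| / 2) ^ q)⁻¹ * |u x - c| ^ q := by
            rw [← div_eq_inv_mul, one_le_div (by positivity)]
            gcongr
          have h4 : K₀ ≤ a * |u x - c| ^ q := by
            rw [ha, mul_assoc]
            exact le_mul_of_one_le_right hK₀ h3
          linarith [hK x]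
        · have h5 : |c| / 2 ≤ |u x| := by
            have := abs_sub_abs_le_abs_sub c (u x)
            rw [abs_sub_comm] at this
            linarith
          have h3 : 1 ≤ ((|c| / 2) ^ 2)⁻¹ * u x ^ 2 := by
            rw [← div_eq_inv_mul, one_le_div (by positivity), ← sq_abs (u x)]
            gcongr
          have h4 : C₃ * V x ≤ b * (V x * u x ^ 2) := by
            have : b * (V x * u x ^ 2) = C₃ * V x * (((|c| / 2) ^ 2)⁻¹ * u x ^ 2) := by
              rw [hb]
              ring
            rw [this]
            exact le_mul_of_one_le_right (by positivity) h3
          linarith [hKV x]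
    _ = ENNReal.ofReal a * (∫⁻ x, ENNReal.ofReal (|u x - c| ^ q)) +
          ENNReal.ofReal b * (∫⁻ x, ENNReal.ofReal (V x * u x ^ 2)) := by
        have hmeas : Measurable fun x => ENNReal.ofReal (|u x - c| ^ q) :=
          ((measurable_abs.comp (hu.sub_const c)).pow_const q).ennreal_ofReal
        rw [lintegral_add_left (hmeas.const_mul _), lintegral_const_mul' _ _ ENNReal.ofReal_ne_top,
          lintegral_const_mul' _ _ ENNReal.ofReal_ne_top]
    _ < ⊤ := ENNReal.add_lt_top.2 ⟨ENNReal.mul_lt_top ENNReal.ofReal_lt_top hL,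
        ENNReal.mul_lt_top ENNReal.ofReal_lt_top (lt_of_le_of_lt le_add_self hfin)⟩

lemma exists_lintegral_growth_le (hα : 0 < α) (hN : 2 * α < N) (hV : Continuous V)
    (hKc : Continuous K) {K₀ C₃ : ℝ} (hK₀ : 0 ≤ K₀) (hC₃ : 0 ≤ C₃) (hV0 : ∀ x, 0 < V x)
    (hK0 : ∀ x, 0 < K x) (hK : ∀ x, K x ≤ K₀) (hKV : ∀ x, K x ≤ C₃ * V x) {M : ℝ} (hM : 0 ≤ M) :
    ∃ S : ℝ, 0 ≤ S ∧ ∀ u : EN N → ℝ, Measurable u → normSq α V u ≤ ENNReal.ofReal M →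
      ∫⁻ x, ENNReal.ofReal (u x ^ 2 + |u x| ^ critExp N α) ∂weightMeasure K ≤
        ENNReal.ofReal S := by
  obtain ⟨C, hC0, hC⟩ := exists_sobolev_decomposition hα hN hV hV0 hM
  have hq := critExp_pos hα hN
  set q := critExp N α with hqdef
  set I := (∫⁻ x, ENNReal.ofReal (K x)).toReal with hI
  have hI0 : 0 ≤ I := ENNReal.toReal_nonneg
  refine ⟨C₃ * M + (2 ^ q * K₀ * C + 2 ^ q * C ^ (q / 2) * I), by positivity, fun u hu huM => ?_⟩
  obtain ⟨c, hc, hL, -⟩ := hC u hu huM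
  have hVm := hV.measurable
  have hKm := hKc.measurable
  have hconst : ENNReal.ofReal (|c| ^ q) * ∫⁻ x, ENNReal.ofReal (K x) ≤
      ENNReal.ofReal (C ^ (q / 2) * I) := by
    rcases eq_or_ne c 0 with rfl | hc0
    · rw [abs_zero, Real.zero_rpow hq.ne', ENNReal.ofReal_zero, zero_mul]
      exact zero_le
    · have hfin := lintegral_weight_lt_top hK₀ hC₃ hV0 hK hKV hu
        (huM.trans_lt ENNReal.ofReal_lt_top) hq.le hc0 (hL.trans_lt ENNReal.ofReal_lt_top)
      rw [ENNReal.ofReal_mul (by positivity), hI, ENNReal.ofReal_toReal hfin.ne,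
        abs_rpow_eq_sq_rpow]
      gcongr
  have hpt : ∀ t : ℝ, |t| ^ q ≤ 2 ^ q * |t - c| ^ q + 2 ^ q * |c| ^ q := by
    intro t
    have h1 : |t| ≤ |t - c| + |c| := by simpa using abs_add_le (t - c) c
    have hA : 0 ≤ (2 : ℝ) ^ q * |t - c| ^ q := by positivity
    have hB : 0 ≤ (2 : ℝ) ^ q * |c| ^ q := by positivity
    rcases le_total |t - c| |c| with h | h
    · have : |t| ^ q ≤ (2 * |c|) ^ q := by
        gcongr
        linarith
      rw [Real.mul_rpow (by norm_num) (abs_nonneg _)] at this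
      linarith
    · have : |t| ^ q ≤ (2 * |t - c|) ^ q := by
        gcongr
        linarith
      rw [Real.mul_rpow (by norm_num) (abs_nonneg _)] at this
      linarith
  rw [weightMeasure, lintegral_withDensity_eq_lintegral_mul _ hKm.ennreal_ofReal
    (measurable_growth hu).ennreal_ofReal]
  calc ∫⁻ x, ENNReal.ofReal (K x) * ENNReal.ofReal (u x ^ 2 + |u x| ^ q)
      ≤ ∫⁻ x, (ENNReal.ofReal C₃ * ENNReal.ofReal (V x * u x ^ 2) +
          (ENNReal.ofReal (2 ^ q * K₀) * ENNReal.ofReal (|u x - c| ^ q) +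
            ENNReal.ofReal (2 ^ q) * (ENNReal.ofReal (|c| ^ q) * ENNReal.ofReal (K x)))) := by
        refine lintegral_mono fun x => ?_
        have hVx := hV0 x
        have hKx := hK0 x
        rw [← ENNReal.ofReal_mul hKx.le, ← ENNReal.ofReal_mul hC₃,
          ← ENNReal.ofReal_mul (by positivity), ← ENNReal.ofReal_mul (by positivity),
          ← ENNReal.ofReal_mul (by positivity), ← ENNReal.ofReal_add (by positivity) (by positivity),
          ← ENNReal.ofReal_add (by positivity) (by positivity)]
        apply ENNReal.ofReal_le_ofReal
        have h1 : K x * u x ^ 2 ≤ C₃ * (V x * u x ^ 2) := by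
          rw [← mul_assoc]
          gcongr
          exact hKV x
        have h2 := mul_le_mul_of_nonneg_left (hpt (u x)) hKx.le
        have h3 : K x * (2 ^ q * |u x - c| ^ q) ≤ 2 ^ q * K₀ * |u x - c| ^ q := by
          rw [← mul_assoc, mul_comm (K x)]
          gcongr
          exact hK x
        nlinarith
    _ = ENNReal.ofReal C₃ * (∫⁻ x, ENNReal.ofReal (V x * u x ^ 2)) +
          (ENNReal.ofReal (2 ^ q * K₀) * (∫⁻ x, ENNReal.ofReal (|u x - c| ^ q)) +
            ENNReal.ofReal (2 ^ q) * (ENNReal.ofReal (|c| ^ q) * ∫⁻ x, ENNReal.ofReal (K x))) := by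
        have hm1 : Measurable fun x => ENNReal.ofReal (V x * u x ^ 2) := by fun_prop
        have hm2 : Measurable fun x => ENNReal.ofReal (|u x - c| ^ q) :=
          ((measurable_abs.comp (hu.sub_const c)).pow_const q).ennreal_ofReal
        rw [lintegral_add_left (hm1.const_mul _), lintegral_add_left (hm2.const_mul _),
          lintegral_const_mul' _ _ ENNReal.ofReal_ne_top,
          lintegral_const_mul' _ _ ENNReal.ofReal_ne_top,
          lintegral_const_mul' _ _ ENNReal.ofReal_ne_top,
          lintegral_const_mul' _ _ ENNReal.ofReal_ne_top]
    _ ≤ ENNReal.ofReal C₃ * ENNReal.ofReal M + (ENNReal.ofReal (2 ^ q * K₀) * ENNReal.ofReal C +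
          ENNReal.ofReal (2 ^ q) * ENNReal.ofReal (C ^ (q / 2) * I)) := by
        gcongr
        exact le_add_self.trans huM
    _ = _ := by
        rw [← ENNReal.ofReal_mul hC₃, ← ENNReal.ofReal_mul (by positivity),
          ← ENNReal.ofReal_mul (by positivity), ← ENNReal.ofReal_add (by positivity) (by positivity),
          ← ENNReal.ofReal_add (by positivity) (by positivity), mul_assoc (2 ^ q) _ I]

lemma weightMeasure_ball_lt_top {K₀ : ℝ} (hK : ∀ x, K x ≤ K₀) (R : ℝ) :
    weightMeasure K (ball 0 R) < ⊤ := by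
  rw [weightMeasure, withDensity_apply _ measurableSet_ball]
  calc ∫⁻ x in ball 0 R, ENNReal.ofReal (K x)
      ≤ ∫⁻ _ in ball (0 : EN N) R, ENNReal.ofReal K₀ :=
        lintegral_mono fun x => ENNReal.ofReal_le_ofReal (hK x)
    _ < ⊤ := by
        rw [setLIntegral_const]
        exact ENNReal.mul_lt_top ENNReal.ofReal_lt_top measure_ball_lt_top

/-- Superlevel sets of a bounded sequence in `X` carry uniformly little `K`-mass at infinity. -/
lemma exists_radius_weightMeasure_le (hα : 0 < α) (hN : 2 * α < N) (hV : Continuous V)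
    {K₀ C₃ : ℝ} (hK₀ : 0 ≤ K₀) (hC₃ : 0 ≤ C₃) (hV0 : ∀ x, 0 < V x)
    (hK : ∀ x, K x ≤ K₀) (hKV : ∀ x, K x ≤ C₃ * V x) (h2 : H2 K) {M : ℝ} (hM : 0 ≤ M)
    {v : ℕ → EN N → ℝ} (hv : ∀ n, Measurable (v n)) (hvM : ∀ n, normSq α V (v n) ≤ ENNReal.ofReal M)
    {δ ε : ℝ} (hδ : 0 < δ) (hε : 0 < ε) :
    ∃ R₀ : ℝ, ∀ R : ℝ, R₀ ≤ R → ∀ n,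
      weightMeasure K ({x | δ ≤ |v n x|} ∩ (ball 0 R)ᶜ) ≤ ENNReal.ofReal ε := by
  have hq := critExp_pos hα hN
  by_cases hfin : ∫⁻ x, ENNReal.ofReal (K x) < ⊤
  · have : IsFiniteMeasure (weightMeasure K) := isFiniteMeasure_withDensity hfin.ne
    have ht := isTightMeasureSet_iff_tendsto_measure_norm_gt.1
      (isTightMeasureSet_singleton (μ := weightMeasure K))
    simp only [Set.mem_singleton_iff, iSup_iSup_eq_left] at ht
    obtain ⟨r, hr⟩ := eventually_atTop.1
      (ENNReal.tendsto_nhds_zero.1 ht (ENNReal.ofReal ε) (ENNReal.ofReal_pos.2 hε))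
    refine ⟨r + 1, fun R hR n => (measure_mono ?_).trans (hr r le_rfl)⟩
    rintro x ⟨-, hx⟩
    simp only [Set.mem_compl_iff, mem_ball, dist_zero_right, not_lt] at hx
    simp only [Set.mem_ofPred_eq]
    linarith
  · obtain ⟨C, hC0, hC⟩ := exists_sobolev_decomposition hα hN hV hV0 hM
    have hset : ∀ n, MeasurableSet {x | δ ≤ |v n x|} := fun n =>
      measurableSet_le measurable_const (measurable_abs.comp (hv n))
    have hδq : 0 < δ ^ critExp N α := by positivity
    have hvol : ∀ n, volume {x | δ ≤ |v n x|} ≤ ENNReal.ofReal (C / δ ^ critExp N α + 1) := by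
      intro n
      obtain ⟨c, -, hL, -⟩ := hC (v n) (hv n) (hvM n)
      have hc : c = 0 := by
        by_contra hc
        exact hfin (lintegral_weight_lt_top hK₀ hC₃ hV0 hK hKV (hv n)
          ((hvM n).trans_lt ENNReal.ofReal_lt_top) hq.le hc (hL.trans_lt ENNReal.ofReal_lt_top))
      simp only [hc, sub_zero] at hL
      have hmeas : Measurable fun x => ENNReal.ofReal (|v n x| ^ critExp N α) :=
        ((measurable_abs.comp (hv n)).pow_const _).ennreal_ofReal
      calc volume {x | δ ≤ |v n x|}
          ≤ volume {x | ENNReal.ofReal (δ ^ critExp N α) ≤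
              ENNReal.ofReal (|v n x| ^ critExp N α)} := by
            refine measure_mono fun x hx => ENNReal.ofReal_le_ofReal ?_
            exact Real.rpow_le_rpow hδ.le hx hq.le
        _ ≤ (∫⁻ x, ENNReal.ofReal (|v n x| ^ critExp N α)) / ENNReal.ofReal (δ ^ critExp N α) :=
            meas_ge_le_lintegral_div hmeas.aemeasurable (ENNReal.ofReal_pos.2 hδq).ne'
              ENNReal.ofReal_ne_top
        _ ≤ ENNReal.ofReal C / ENNReal.ofReal (δ ^ critExp N α) := by gcongr
        _ ≤ ENNReal.ofReal (C / δ ^ critExp N α + 1) := by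
            rw [← ENNReal.ofReal_div_of_pos hδq]
            exact ENNReal.ofReal_le_ofReal (by linarith)
    obtain ⟨r₀, hr₀⟩ := h2 (fun n => {x | δ ≤ |v n x|}) (C / δ ^ critExp N α + 1) (by positivity)
      hset hvol ε hε
    refine ⟨r₀, fun R hR n => ?_⟩
    have hball : (ball (0 : EN N) R)ᶜ = {x | R ≤ ‖x‖} := by
      ext x
      simp
    rw [weightMeasure, withDensity_apply _ ((hset n).inter measurableSet_ball.compl), hball]
    exact hr₀ R hR n

lemma integral_weightMeasure (hKc : Continuous K) (hK0 : ∀ x, 0 < K x) (g : EN N → ℝ) :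
    ∫ x, g x ∂weightMeasure K = ∫ x, K x * g x := by
  rw [weightMeasure, integral_withDensity_eq_integral_toReal_smul
    hKc.measurable.ennreal_ofReal (by simp)]
  simp only [ENNReal.toReal_ofReal (hK0 _).le, smul_eq_mul]

lemma normSq_le_of_Xnorm_le (hu : normSq α V u < ⊤) {C : ℝ} (h : Xnorm α V u ≤ C) :
    normSq α V u ≤ ENNReal.ofReal (C ^ 2) := by
  rw [← ENNReal.ofReal_toReal hu.ne]
  apply ENNReal.ofReal_le_ofReal
  rw [Xnorm, ← Real.sqrt_eq_rpow] at h
  rw [← Real.sq_sqrt ENNReal.toReal_nonneg]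
  gcongr

end Weighted

end ZeroMass

/-- Lemma 2.3: convergence of the nonlinear terms along a subsequence. -/
theorem statement6 {N : ℕ} (α : ℝ) (hα : α ∈ Set.Ioo (0 : ℝ) 1) (hN : 2 * α < N)
    (V K : EN N → ℝ) (f : ℝ → ℝ)
    (hV : Continuous V) (hK : Continuous K) (hf : Continuous f)
    (h1 : H1 V K) (h2 : H2 K) (h3 : H3 V K)
    (hf1 : Cf1 f) (hf2 : Cf2 f (critExp N α))
    (u : ℕ → EN N → ℝ) (hu : ∀ n, memX α V (u n))
    (hbdd : ∃ C : ℝ, ∀ n, Xnorm α V (u n) ≤ C)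
    (w : EN N → ℝ) (hw : memX α V w) (hconv : weakConv α V u w) :
    ∃ φ : ℕ → ℕ, StrictMono φ ∧
      Filter.Tendsto (fun n => ∫ x, K x * prim f (u (φ n) x)) Filter.atTop
        (nhds (∫ x, K x * prim f (w x))) ∧
      Filter.Tendsto (fun n => ∫ x, K x * f (u (φ n) x) * u (φ n) x) Filter.atTop
        (nhds (∫ x, K x * f (w x) * w x)) := by
  obtain ⟨hα0, -⟩ := hα
  obtain ⟨hV0, hK0, K₀, hK₀⟩ := h1
  obtain ⟨C₃, hC₃⟩ := h3
  have hKV : ∀ x, K x ≤ C₃ * V x := fun x => (div_le_iff₀ (hV0 x)).1 (hC₃ x)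
  have hK₀0 : 0 ≤ K₀ := (hK0 0).le.trans (hK₀ 0)
  have hC₃0 : 0 ≤ C₃ := (div_pos (hK0 0) (hV0 0)).le.trans (hC₃ 0)
  obtain ⟨C, hC⟩ := hbdd
  set M := C ^ 2 + (normSq α V w).toReal with hMdef
  have hM : 0 ≤ M := by positivity
  have huM : ∀ n, normSq α V (u n) ≤ ENNReal.ofReal M := fun n =>
    (normSq_le_of_Xnorm_le (hu n).2 (hC n)).trans
      (ENNReal.ofReal_le_ofReal (le_add_of_nonneg_right ENNReal.toReal_nonneg))
  have hwM : normSq α V w ≤ ENNReal.ofReal M := by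
    rw [← ENNReal.ofReal_toReal hw.2.ne]
    exact ENNReal.ofReal_le_ofReal (le_add_of_nonneg_left (sq_nonneg C))
  have hzM : ∀ n, normSq α V (fun x => u n x - w x) ≤ ENNReal.ofReal (4 * M) := fun n => by
    refine (memX_sub hV0 hV (hu n) hw).2.trans ?_
    refine (add_le_add (mul_le_mul_right (huM n) 2) (mul_le_mul_right hwM 2)).trans_eq ?_
    rw [ENNReal.ofReal_mul (by norm_num), ENNReal.ofReal_ofNat, ← add_mul]
    norm_num
  have hz : ∀ n, memX α V (fun x => u n x - w x) := fun n =>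
    ⟨(memX_sub hV0 hV (hu n) hw).1, (hzM n).trans_lt ENNReal.ofReal_lt_top⟩
  have havg := tendsto_ballAvg_of_weak hV hV0 hz hzM (by positivity) hconv
  obtain ⟨φ, hφ, hae⟩ := exists_subseq_tendsto_ae hα0 hN hV hV0 hz (by positivity) hzM havg
  have hae' : ∀ᵐ x ∂weightMeasure K, Tendsto (fun n => u (φ n) x) atTop (nhds (w x)) := by
    refine (withDensity_absolutelyContinuous _ _).ae_le ?_
    filter_upwards [hae] with x hx
    simpa using hx.add_const (w x)
  obtain ⟨S, hS, hSb⟩ := exists_lintegral_growth_le hα0 hN hV hK hK₀0 hC₃0 hV0 hK0 hK₀ hKV hM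
  have key : ∀ G : ℝ → ℝ, Continuous G → SubcriticalGrowth G (critExp N α) →
      Tendsto (fun n => ∫ x, K x * G (u (φ n) x)) atTop (nhds (∫ x, K x * G (w x))) := by
    intro G hG hgr
    have := tendsto_integral_comp_of_growth hG hgr (fun n => (hu (φ n)).1) hw.1 hae' hS
      (fun n => hSb _ (hu (φ n)).1 (huM _)) (hSb _ hw.1 hwM) (fun δ hδ ε hε => by
        obtain ⟨R₁, hR₁⟩ := exists_radius_weightMeasure_le hα0 hN hV hK₀0 hC₃0 hV0 hK₀ hKV h2 hM
          (fun n => (hu (φ n)).1) (fun n => huM (φ n)) hδ hε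
        obtain ⟨R₂, hR₂⟩ := exists_radius_weightMeasure_le hα0 hN hV hK₀0 hC₃0 hV0 hK₀ hKV h2 hM
          (v := fun _ => w) (fun _ => hw.1) (fun _ => hwM) hδ hε
        exact ⟨Metric.ball 0 (max R₁ R₂), measurableSet_ball, weightMeasure_ball_lt_top hK₀ _,
          hR₁ _ (le_max_left _ _), hR₂ _ (le_max_right _ _) 0⟩)
    simpa only [integral_weightMeasure hK hK0] using this
  refine ⟨φ, hφ, key _ (continuous_prim hf) (subcriticalGrowth_prim
    (one_lt_two.trans (two_lt_critExp hα0 hN)) hf hf1 hf2), ?_⟩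
  simpa only [mul_assoc] using key (fun t => f t * t) (hf.mul continuous_id)
    (subcriticalGrowth_mul_self hf hf1 hf2)
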